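/- arXiv:2404.11103 — 15 statements merged into one kernel-verified Lean document; each statement's English description precedes it below -/
import Mathlib

section
/- Let G = (U, V, E) be a finite bipartite graph and let # be an element not in U ∪ V. Let μ be a probability distribution on U ∪ {#} and ν a probability distribution on V ∪ {#}. Let ε > 0 and assume that every vertex cover C = C₁ ⊔ C₂ of G with C₁ ⊆ U and C₂ ⊆ V satisfies μ(C₁) + ν(C₂) ≥ ε. Let S be the set formed by m independent samples from μ and S' the set formed by m' independent samples from ν, where m and m' are positive integers with m·m' ≥ 100·|U|/ε² and m, m' ≥ 100/ε. Then with probability at least 0.99 there exist x ∈ S and y ∈ S' such that {x, y} ∈ E. -/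
open scoped Classical

open Finset in
/-- The probability that `k` independent draws all satisfy a predicate. -/
lemma sum_forall_prod_eq_pow {α : Type*} [Fintype α] (w : α → ℝ) (A : α → Prop) (k : ℕ) :
    ∑ g : Fin k → α, (if ∀ j, A (g j) then ∏ j, w (g j) else 0)
      = (∑ a, if A a then w a else 0) ^ k := by
  have h := (Finset.prod_univ_sum (fun _ : Fin k => (univ : Finset α))
    (fun _ a => if A a then w a else 0)).symm
  simp only [Fintype.piFinset_univ, prod_const, card_univ, Fintype.card_fin] at h
  rw [← h]
  refine sum_congr rfl fun g _ => ?_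
  rw [Finset.prod_ite_zero]
  simp

lemma one_sub_sum_le_prod_one_sub_of_le_one {ι : Type*} (s : Finset ι) (a : ι → ℝ)
    (h0 : ∀ i, 0 ≤ a i) (h1 : ∀ i, a i ≤ 1) :
    1 - ∑ i ∈ s, a i ≤ ∏ i ∈ s, (1 - a i) := by
  induction s using Finset.induction_on with
  | empty => simp
  | insert i s hi ih =>
    rw [Finset.sum_insert hi, Finset.prod_insert hi]
    have hle : ∏ j ∈ s, (1 - a j) ≤ 1 :=
      Finset.prod_le_one (fun j _ => sub_nonneg.2 (h1 j)) fun j _ => by linarith [h0 j]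
    nlinarith [h0 i, h1 i]

/-- Negative correlation of the events that the various elements are drawn. -/
lemma sum_prod_mul_prod_ite_le {U : Type*} [Fintype U] (μ : Option U → ℝ)
    (hμ0 : ∀ u, 0 ≤ μ u) (hμ1 : ∑ u, μ u = 1) (x : U → ℝ) (hx0 : ∀ u, 0 ≤ x u)
    (hx1 : ∀ u, x u ≤ 1) (m : ℕ) :
    ∑ f : Fin m → Option U, (∏ i, μ (f i)) * ∏ u, (if ∃ i, f i = some u then x u else 1)
      ≤ ∏ u, ((1 - x u) * (1 - μ (some u)) ^ m + x u) := by
  have hμle : ∀ a, μ a ≤ 1 := fun a =>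
    hμ1 ▸ Finset.single_le_sum (fun b _ => hμ0 b) (Finset.mem_univ a)
  have hexp : ∀ f : Fin m → Option U,
      (∏ i, μ (f i)) * ∏ u, (if ∃ i, f i = some u then x u else 1)
      = ∑ t : Finset U, ((∏ u ∈ t, (1 - x u)) * ∏ u ∈ Finset.univ \ t, x u) *
          (if ∀ i, ∀ u ∈ t, f i ≠ some u then ∏ i, μ (f i) else 0) := by
    intro f
    have h1 : ∀ u, (if ∃ i, f i = some u then x u else 1)
        = (if ∀ i, f i ≠ some u then 1 - x u else 0) + x u := by
      intro u
      by_cases h : ∃ i, f i = some u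
      · rw [if_pos h, if_neg (by push Not; exact h)]; ring
      · rw [if_neg h, if_pos (by push Not at h; exact h)]; ring
    simp_rw [h1]
    rw [Finset.prod_add, Finset.mul_sum, Finset.powerset_univ]
    refine Finset.sum_congr rfl fun t _ => ?_
    rw [Finset.prod_ite_zero]
    by_cases h : ∀ i, ∀ u ∈ t, f i ≠ some u
    · rw [if_pos h, if_pos (fun u hu i => h i u hu)]; ring
    · rw [if_neg h, if_neg (fun h' => h fun i u hu => h' u hu i)]; ring
  simp_rw [hexp]
  rw [Finset.sum_comm, Finset.prod_add, Finset.powerset_univ]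
  refine Finset.sum_le_sum fun t _ => ?_
  have hpow : ∑ f : Fin m → Option U,
      (if ∀ i, ∀ u ∈ t, f i ≠ some u then ∏ i, μ (f i) else 0)
      = (∑ a, if ∀ u ∈ t, a ≠ some u then μ a else 0) ^ m := by
    convert sum_forall_prod_eq_pow μ (fun a => ∀ u ∈ t, a ≠ some u) m
  rw [← Finset.mul_sum, hpow, Finset.prod_mul_distrib, mul_right_comm]
  refine mul_le_mul_of_nonneg_right ?_ (Finset.prod_nonneg fun u _ => hx0 u)
  refine mul_le_mul_of_nonneg_left ?_ (Finset.prod_nonneg fun u _ => sub_nonneg.2 (hx1 u))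
  rw [Finset.prod_pow]
  have hsum : (∑ a, if ∀ u ∈ t, a ≠ some u then μ a else 0) = 1 - ∑ u ∈ t, μ (some u) := by
    rw [← hμ1, Fintype.sum_option, Fintype.sum_option]
    have : ∀ u, (if ∀ v ∈ t, some u ≠ some v then μ (some u) else 0)
        = μ (some u) - if u ∈ t then μ (some u) else 0 := by
      intro u
      by_cases h : u ∈ t
      · rw [if_neg (fun h' => h' u h rfl), if_pos h]; ring
      · rw [if_pos (fun v hv he => h (by rwa [Option.some.inj he])), if_neg h]; ring
    simp only [this, Finset.sum_sub_distrib]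
    simp
    ring
  refine pow_le_pow_left₀ ?_ ?_ m
  · exact Finset.sum_nonneg fun a _ => by split_ifs <;> simp [hμ0]
  · rw [hsum]
    exact one_sub_sum_le_prod_one_sub_of_le_one t _ (fun u => hμ0 _) fun u => hμle _

/-- A maximum-size vector of a polymatroid truncated by the box below `μ`. -/
lemma exists_le_of_submodular {U : Type*} [Fintype U] (μ : U → ℝ) (hμ : ∀ u, 0 ≤ μ u)
    (g : Finset U → ℝ) (hg0 : g ∅ = 0) (hgnonneg : ∀ T, 0 ≤ g T)
    (hsub : ∀ A B, g (A ∪ B) + g (A ∩ B) ≤ g A + g B)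
    (ε : ℝ) (hε : ∀ T : Finset U, ε ≤ ∑ u ∈ Tᶜ, μ u + g T) :
    ∃ p : U → ℝ, (∀ u, 0 ≤ p u) ∧ (∀ u, p u ≤ μ u) ∧ (∀ T, ∑ u ∈ T, p u ≤ g T) ∧
      ε ≤ ∑ u, p u := by
  let K : Set (U → ℝ) := Set.Icc 0 μ ∩ {p | ∀ T : Finset U, ∑ u ∈ T, p u ≤ g T}
  have hK : IsCompact K := by
    refine isCompact_Icc.inter_right ?_
    simp only [Set.ofPred_forall]
    exact isClosed_iInter fun T => isClosed_le (by fun_prop) continuous_const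
  have hne : K.Nonempty := ⟨0, ⟨le_rfl, hμ⟩, fun T => by simpa using hgnonneg T⟩
  obtain ⟨p, ⟨⟨hp0, hpμ⟩, hpg⟩, hmax⟩ :=
    hK.exists_isMaxOn hne (f := fun p => ∑ u, p u) (by fun_prop)
  refine ⟨p, hp0, hpμ, hpg, ?_⟩
  have htight : ∀ u, p u < μ u → ∃ T : Finset U, u ∈ T ∧ ∑ v ∈ T, p v = g T := by
    intro u hu
    by_contra! hT
    have hev : ∀ᶠ δ : ℝ in nhdsWithin 0 (Set.Ioi 0), 0 < δ ∧ p u + δ ≤ μ u ∧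
        ∀ T : Finset U, u ∈ T → ∑ v ∈ T, p v + δ ≤ g T := by
      have hsmall : ∀ a b : ℝ, a < b → ∀ᶠ δ : ℝ in nhdsWithin 0 (Set.Ioi 0), a + δ ≤ b := by
        intro a b hab
        filter_upwards [nhdsWithin_le_nhds (Iio_mem_nhds (sub_pos.2 hab))] with δ hδ
        linarith [Set.mem_Iio.1 hδ]
      refine (Filter.eventually_mem_set.2 self_mem_nhdsWithin).and ((hsmall _ _ hu).and ?_)
      rw [Filter.eventually_all]
      intro T
      by_cases h : u ∈ T
      · filter_upwards [hsmall _ _ (lt_of_le_of_ne (hpg T) (hT T h))] with δ hδ _ using hδ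
      · exact Filter.Eventually.of_forall fun δ h' => absurd h' h
    obtain ⟨δ, hδ, hδμ, hδg⟩ := hev.exists
    have hsum : ∀ T : Finset U, ∑ v ∈ T, (p v + if v = u then δ else 0)
        = ∑ v ∈ T, p v + if u ∈ T then δ else 0 := by
      intro T
      rw [Finset.sum_add_distrib, Finset.sum_ite_eq']
    have hmem : (fun v => p v + if v = u then δ else 0) ∈ K := by
      refine ⟨⟨fun v => ?_, fun v => ?_⟩, fun T => ?_⟩
      · have := hp0 v
        simp only [Pi.zero_apply] at this ⊢
        split_ifs <;> linarith
      · have := hpμ v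
        dsimp only
        split_ifs with h
        · rw [h]; exact hδμ
        · linarith
      · rw [hsum]
        split_ifs with h
        · exact hδg T h
        · simpa using hpg T
    have hle := hmax hmem
    simp only [Set.mem_ofPred_eq, hsum, Finset.mem_univ, if_true] at hle
    linarith
  have hunion : ∀ A B : Finset U, ∑ v ∈ A, p v = g A → ∑ v ∈ B, p v = g B →
      ∑ v ∈ A ∪ B, p v = g (A ∪ B) := by
    intro A B hA hB
    have h1 := Finset.sum_union_inter (s₁ := A) (s₂ := B) (f := p)
    linarith [hsub A B, hpg (A ∪ B), hpg (A ∩ B)]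
  let F : Finset (Finset U) := Finset.univ.filter fun T => ∑ v ∈ T, p v = g T
  have hF : ∑ v ∈ F.sup id, p v = g (F.sup id) := by
    refine Finset.sup_induction (p := fun T : Finset U => ∑ v ∈ T, p v = g T) ?_ ?_ ?_
    · simp [hg0]
    · exact fun A hA B hB => hunion A B hA hB
    · exact fun T hT => (Finset.mem_filter.1 hT).2
  have hcompl : ∑ u ∈ (F.sup id)ᶜ, p u = ∑ u ∈ (F.sup id)ᶜ, μ u := by
    refine Finset.sum_congr rfl fun u hu => ?_
    by_contra hne'
    obtain ⟨T, huT, hT⟩ := htight u (lt_of_le_of_ne (hpμ u) hne')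
    refine Finset.mem_compl.1 hu ?_
    exact (Finset.le_sup (f := id) (Finset.mem_filter.2 ⟨Finset.mem_univ T, hT⟩) :
      T ≤ F.sup id) huT
  rw [← Finset.sum_compl_add_sum (F.sup id), hcompl, hF]
  exact hε _

lemma exp_neg_le_chord {c x : ℝ} (hc : 0 < c) (hx : 0 ≤ x) (hxc : x ≤ c) :
    x / c * (1 - Real.exp (-c)) ≤ 1 - Real.exp (-x) := by
  have h1 : x / c ≤ 1 := (div_le_one hc).2 hxc
  have h := convexOn_exp.2 (Set.mem_univ (0 : ℝ)) (Set.mem_univ (-c)) (sub_nonneg.2 h1)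
    (div_nonneg hx hc.le) (by ring)
  have h2 : (1 - x / c) • (0 : ℝ) + (x / c) • (-c) = -x := by
    simp only [smul_eq_mul]
    field_simp
    ring
  rw [h2, Real.exp_zero] at h
  simp only [smul_eq_mul] at h
  linarith

lemma exp_neg_natCast_le (k : ℕ) : Real.exp (-(k : ℝ)) ≤ ((2.718 : ℝ) ^ k)⁻¹ := by
  rw [Real.exp_neg]
  refine inv_anti₀ (by positivity) ?_
  rw [← mul_one (k : ℝ), Real.exp_nat_mul]
  exact pow_le_pow_left₀ (by norm_num) (by linarith [Real.exp_one_gt_d9]) k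

lemma prod_one_sub_exp_mul_le {U : Type*} [Fintype U] (p : U → ℝ) (hp : ∀ u, 0 ≤ p u)
    (s t : ℝ) (hs : 0 < s) (hst : s ≤ t) (h1 : 100 ≤ s * ∑ u, p u)
    (h2 : 100 * (Fintype.card U : ℝ) ≤ s * t * (∑ u, p u) ^ 2) :
    ∏ u, (1 - (1 - Real.exp (-(s * p u))) * (1 - Real.exp (-(t * p u)))) ≤ 0.01 := by
  have ht : 0 < t := hs.trans_le hst
  have e1 : Real.exp (-1) ≤ 0.37 := by
    have := exp_neg_natCast_le 1
    norm_num at this ⊢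
    linarith
  have e5 : Real.exp (-5) ≤ 0.01 := by
    have := exp_neg_natCast_le 5
    norm_num at this ⊢
    linarith
  have e6 : Real.exp (-6) ≤ 0.0025 := by
    have := exp_neg_natCast_le 6
    norm_num at this ⊢
    linarith
  have hnn : ∀ r : ℝ, 0 < r → ∀ u, 0 ≤ 1 - Real.exp (-(r * p u)) := fun r hr u => by
    rw [sub_nonneg, Real.exp_le_one_iff]
    linarith [mul_nonneg hr.le (hp u)]
  have hle1 : ∀ r : ℝ, ∀ u, 1 - Real.exp (-(r * p u)) ≤ 1 := fun r u => by
    linarith [Real.exp_pos (-(r * p u))]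
  have hprod0 : ∀ u, 0 ≤ (1 - Real.exp (-(s * p u))) * (1 - Real.exp (-(t * p u))) :=
    fun u => mul_nonneg (hnn s hs u) (hnn t ht u)
  have hprod1 : ∀ u, (1 - Real.exp (-(s * p u))) * (1 - Real.exp (-(t * p u))) ≤ 1 :=
    fun u => mul_le_one₀ (hle1 s u) (hnn t ht u) (hle1 t u)
  by_cases hbig : ∃ u, 6 ≤ s * p u
  · obtain ⟨u, hu⟩ := hbig
    rw [← Finset.mul_prod_erase _ _ (Finset.mem_univ u)]
    have hrest : ∏ v ∈ Finset.univ.erase u,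
        (1 - (1 - Real.exp (-(s * p v))) * (1 - Real.exp (-(t * p v)))) ≤ 1 :=
      Finset.prod_le_one (fun v _ => sub_nonneg.2 (hprod1 v)) fun v _ => by linarith [hprod0 v]
    refine (mul_le_of_le_one_right (sub_nonneg.2 (hprod1 u)) hrest).trans ?_
    have hsx : Real.exp (-(s * p u)) ≤ 0.0025 :=
      (Real.exp_le_exp.2 (by linarith)).trans e6
    have htx : Real.exp (-(t * p u)) ≤ 0.0025 :=
      (Real.exp_le_exp.2 (by linarith [mul_le_mul_of_nonneg_right hst (hp u)])).trans e6
    have := mul_pos (Real.exp_pos (-(s * p u))) (Real.exp_pos (-(t * p u)))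
    norm_num at hsx htx ⊢
    linarith
  push Not at hbig
  suffices hsum : 5 ≤ ∑ u, (1 - Real.exp (-(s * p u))) * (1 - Real.exp (-(t * p u))) by
    calc _ ≤ ∏ u, Real.exp (-((1 - Real.exp (-(s * p u))) * (1 - Real.exp (-(t * p u))))) :=
          Finset.prod_le_prod (fun u _ => sub_nonneg.2 (hprod1 u))
            fun u _ => Real.one_sub_le_exp_neg _
      _ = Real.exp (-∑ u, (1 - Real.exp (-(s * p u))) * (1 - Real.exp (-(t * p u)))) := by
          rw [← Real.exp_sum, Finset.sum_neg_distrib]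
      _ ≤ Real.exp (-5) := Real.exp_le_exp.2 (by linarith)
      _ ≤ 0.01 := e5
  have hone : ∀ x : ℝ, 0 ≤ x → x ≤ 1 → 0.63 * x ≤ 1 - Real.exp (-x) := fun x h0 hx => by
    have := exp_neg_le_chord one_pos h0 hx
    rw [div_one] at this
    norm_num at e1 ⊢
    nlinarith
  have hsix : ∀ u, 0.166 * (s * p u) ≤ 1 - Real.exp (-(s * p u)) := fun u => by
    have h0 := mul_nonneg hs.le (hp u)
    have := exp_neg_le_chord (c := 6) (by norm_num) h0 (hbig u).le
    norm_num at e6 ⊢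
    nlinarith
  have hsplit := Finset.sum_filter_add_sum_filter_not Finset.univ (fun u => t * p u ≤ 1) p
  have hsubset : ∀ T : Finset U,
      ∑ u ∈ T, (1 - Real.exp (-(s * p u))) * (1 - Real.exp (-(t * p u)))
        ≤ ∑ u, (1 - Real.exp (-(s * p u))) * (1 - Real.exp (-(t * p u))) := fun T =>
    Finset.sum_le_sum_of_subset_of_nonneg (Finset.subset_univ T) fun u _ _ => hprod0 u
  rcases le_total ((∑ u, p u) / 2) (∑ u ∈ Finset.univ.filter (fun u => t * p u ≤ 1), p u)
    with hL | hL
  · have hterm : 0.39 * (s * t) * ∑ u ∈ Finset.univ.filter (fun u => t * p u ≤ 1), p u ^ 2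
        ≤ ∑ u ∈ Finset.univ.filter (fun u => t * p u ≤ 1),
          (1 - Real.exp (-(s * p u))) * (1 - Real.exp (-(t * p u))) := by
      rw [Finset.mul_sum]
      refine Finset.sum_le_sum fun u hu => ?_
      have htu := (Finset.mem_filter.1 hu).2
      have hs0 := mul_nonneg hs.le (hp u)
      have ht0 := mul_nonneg ht.le (hp u)
      have hsu : s * p u ≤ 1 := (mul_le_mul_of_nonneg_right hst (hp u)).trans htu
      have := mul_le_mul (hone _ hs0 hsu) (hone _ ht0 htu) (by positivity) (hnn s hs u)
      nlinarith [mul_nonneg hs0 ht0]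
    refine le_trans ?_ (hterm.trans (hsubset _))
    have hcs := sq_sum_le_card_mul_sum_sq
      (s := Finset.univ.filter (fun u => t * p u ≤ 1)) (f := p)
    set Q := ∑ u ∈ Finset.univ.filter (fun u => t * p u ≤ 1), p u ^ 2
    have hQ : 0 ≤ Q := Finset.sum_nonneg fun u _ => sq_nonneg _
    have hP : 0 < ∑ u, p u := pos_of_mul_pos_right (by linarith : 0 < s * ∑ u, p u) hs.le
    have hcard : ((Finset.univ.filter (fun u => t * p u ≤ 1)).card : ℝ) ≤ Fintype.card U := by
      exact_mod_cast Finset.card_le_univ _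
    have hn : 0 < (Fintype.card U : ℝ) := by
      rw [Nat.cast_pos, Fintype.card_pos_iff]
      by_contra hempty
      rw [not_nonempty_iff] at hempty
      simp at hP
    have hA : (∑ u, p u) ^ 2 / 4 ≤ Fintype.card U * Q := by
      have := pow_le_pow_left₀ (by positivity) hL 2
      have := mul_le_mul_of_nonneg_right hcard hQ
      linarith
    have hB := mul_le_mul_of_nonneg_left hA (mul_pos hs ht).le
    have hC : (Fintype.card U : ℝ) * 25 ≤ Fintype.card U * (s * t * Q) := by linarith
    have := le_of_mul_le_mul_left hC hn
    norm_num
    linarith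
  · have hterm : 0.63 * 0.166 * s * ∑ u ∈ Finset.univ.filter (fun u => ¬ t * p u ≤ 1), p u
        ≤ ∑ u ∈ Finset.univ.filter (fun u => ¬ t * p u ≤ 1),
          (1 - Real.exp (-(s * p u))) * (1 - Real.exp (-(t * p u))) := by
      rw [Finset.mul_sum]
      refine Finset.sum_le_sum fun u hu => ?_
      have htu := (Finset.mem_filter.1 hu).2
      have hs0 := mul_nonneg hs.le (hp u)
      have hb : 0.63 ≤ 1 - Real.exp (-(t * p u)) := by
        have := (Real.exp_le_exp.2 (by linarith : -(t * p u) ≤ -1)).trans e1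
        norm_num at this ⊢
        linarith
      have := mul_le_mul (hsix u) hb (by norm_num) (hnn s hs u)
      linarith
    refine le_trans ?_ (hterm.trans (hsubset _))
    have hhalf : (∑ u, p u) / 2 ≤ ∑ u ∈ Finset.univ.filter (fun u => ¬ t * p u ≤ 1), p u := by
      linarith
    have := mul_le_mul_of_nonneg_left hhalf hs.le
    linarith

/-- Given the draws on one side, the probability of finding no edge decays exponentially. -/
lemma sum_no_edge_le {U V : Type*} [Fintype U] [Fintype V] (E : U → V → Prop)
    (ν : Option V → ℝ) (hν0 : ∀ v, 0 ≤ ν v) (hν1 : ∑ v, ν v = 1) (p : U → ℝ)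
    (hp : ∀ T : Finset U,
      ∑ u ∈ T, p u ≤ ∑ v ∈ Finset.univ.filter (fun v => ∃ u ∈ T, E u v), ν (some v))
    (T : Finset U) (k : ℕ) :
    ∑ g : Fin k → Option V,
        (if ∀ j, ∀ v, g j = some v → ¬ ∃ u ∈ T, E u v then ∏ j, ν (g j) else 0)
      ≤ ∏ u, (if u ∈ T then Real.exp (-(k * p u)) else 1) := by
  have hpow : ∑ g : Fin k → Option V,
        (if ∀ j, ∀ v, g j = some v → ¬ ∃ u ∈ T, E u v then ∏ j, ν (g j) else 0)
      = (∑ a, if ∀ v, a = some v → ¬ ∃ u ∈ T, E u v then ν a else 0) ^ k := by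
    convert sum_forall_prod_eq_pow ν (fun a => ∀ v, a = some v → ¬ ∃ u ∈ T, E u v) k
  rw [hpow]
  have hsum : (∑ a, if ∀ v, a = some v → ¬ ∃ u ∈ T, E u v then ν a else 0)
      = 1 - ∑ v ∈ Finset.univ.filter (fun v => ∃ u ∈ T, E u v), ν (some v) := by
    rw [← hν1, Fintype.sum_option, Fintype.sum_option, Finset.sum_filter]
    have : ∀ v, (if ∀ v', some v = some v' → ¬ ∃ u ∈ T, E u v' then ν (some v) else 0)
        = ν (some v) - if ∃ u ∈ T, E u v then ν (some v) else 0 := by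
      intro v
      by_cases h : ∃ u ∈ T, E u v
      · rw [if_neg (fun h' => h' v rfl h), if_pos h]; ring
      · rw [if_pos (fun v' he => Option.some.inj he ▸ h), if_neg h]; ring
    simp only [this, Finset.sum_sub_distrib]
    rw [if_pos (by simp)]
    ring
  have hle : (∑ a, if ∀ v, a = some v → ¬ ∃ u ∈ T, E u v then ν a else 0)
      ≤ Real.exp (-∑ u ∈ T, p u) := by
    rw [hsum]
    exact (by linarith [hp T] : _ ≤ 1 - ∑ u ∈ T, p u).trans (Real.one_sub_le_exp_neg _)
  refine (pow_le_pow_left₀ (Finset.sum_nonneg fun a _ => ?_) hle k).trans_eq ?_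
  · split_ifs <;> simp [hν0]
  · rw [Finset.prod_ite_mem, Finset.univ_inter, ← Real.exp_sum, ← Real.exp_nat_mul,
      Finset.sum_neg_distrib, ← Finset.mul_sum, mul_neg]

/-- The probability that no edge is found, bounded by a product over one side. -/
lemma sum_mul_sum_no_edge_le {U V : Type*} [Fintype U] [Fintype V] (E : U → V → Prop)
    (μ : Option U → ℝ) (ν : Option V → ℝ)
    (hμ0 : ∀ u, 0 ≤ μ u) (hμ1 : ∑ u, μ u = 1) (hν0 : ∀ v, 0 ≤ ν v) (hν1 : ∑ v, ν v = 1)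
    (p : U → ℝ) (hp0 : ∀ u, 0 ≤ p u) (hpμ : ∀ u, p u ≤ μ (some u))
    (hpg : ∀ T : Finset U,
      ∑ u ∈ T, p u ≤ ∑ v ∈ Finset.univ.filter (fun v => ∃ u ∈ T, E u v), ν (some v))
    (m m' : ℕ) :
    ∑ f : Fin m → Option U, (∏ i, μ (f i)) *
      ∑ g : Fin m' → Option V, (if ∀ j, ∀ v, g j = some v →
        ¬ ∃ u ∈ Finset.univ.filter (fun u => ∃ i, f i = some u), E u v
        then ∏ j, ν (g j) else 0)
      ≤ ∏ u, (1 - (1 - Real.exp (-(m' * p u))) * (1 - Real.exp (-(m * p u)))) := by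
  have hx1 : ∀ u, Real.exp (-(m' * p u)) ≤ 1 := fun u => by
    rw [Real.exp_le_one_iff]
    linarith [mul_nonneg m'.cast_nonneg (hp0 u)]
  have hμle : ∀ a, μ a ≤ 1 := fun a =>
    hμ1 ▸ Finset.single_le_sum (fun b _ => hμ0 b) (Finset.mem_univ a)
  calc _ ≤ ∑ f : Fin m → Option U, (∏ i, μ (f i)) *
        ∏ u, (if ∃ i, f i = some u then Real.exp (-(m' * p u)) else 1) := by
        refine Finset.sum_le_sum fun f _ => ?_
        have hf : 0 ≤ ∏ i, μ (f i) := Finset.prod_nonneg fun i _ => hμ0 _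
        obtain ⟨T, hTf⟩ : ∃ T, T = Finset.univ.filter fun u => ∃ i, f i = some u := ⟨_, rfl⟩
        have hmem : ∀ u, (∃ i, f i = some u) ↔ u ∈ T := by simp [hTf]
        have hT := sum_no_edge_le E ν hν0 hν1 p hpg T m'
        rw [← hTf]
        refine mul_le_mul_of_nonneg_left (le_trans (le_of_eq ?_) (hT.trans_eq ?_)) hf
        · congr!
        · refine Finset.prod_congr rfl fun u _ => ?_
          simp only [hmem]
    _ ≤ ∏ u, ((1 - Real.exp (-(m' * p u))) * (1 - μ (some u)) ^ m
          + Real.exp (-(m' * p u))) :=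
        sum_prod_mul_prod_ite_le μ hμ0 hμ1 _ (fun u => (Real.exp_pos _).le) hx1 m
    _ ≤ ∏ u, (1 - (1 - Real.exp (-(m' * p u))) * (1 - Real.exp (-(m * p u)))) := by
        refine Finset.prod_le_prod (fun u _ => ?_) fun u _ => ?_
        · exact add_nonneg (mul_nonneg (sub_nonneg.2 (hx1 u))
            (pow_nonneg (sub_nonneg.2 (hμle _)) _)) (Real.exp_pos _).le
        · have h1 : (1 - μ (some u)) ^ m ≤ Real.exp (-(m * p u)) := by
            rw [← mul_neg, Real.exp_nat_mul]
            refine pow_le_pow_left₀ (sub_nonneg.2 (hμle _)) ?_ m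
            exact (sub_le_sub_left (hpμ u) 1).trans (Real.one_sub_le_exp_neg _)
          have := mul_le_mul_of_nonneg_left h1 (sub_nonneg.2 (hx1 u))
          linarith

/-- The probabilities of finding an edge and of finding none add up to one. -/
lemma sum_edge_add_sum_no_edge {U V : Type*} [Fintype U] [Fintype V] (E : U → V → Prop)
    (μ : Option U → ℝ) (ν : Option V → ℝ) (hμ1 : ∑ u, μ u = 1) (hν1 : ∑ v, ν v = 1)
    (m m' : ℕ) :
    (∑ f : Fin m → Option U, ∑ g : Fin m' → Option V,
      (if ∃ (u : U) (v : V), E u v ∧ (∃ i, f i = some u) ∧ (∃ j, g j = some v)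
       then (∏ i, μ (f i)) * (∏ j, ν (g j)) else 0)) +
      ∑ f : Fin m → Option U, (∏ i, μ (f i)) *
      ∑ g : Fin m' → Option V, (if ∀ j, ∀ v, g j = some v →
        ¬ ∃ u ∈ Finset.univ.filter (fun u => ∃ i, f i = some u), E u v
        then ∏ j, ν (g j) else 0) = 1 := by
  have hone : ∑ f : Fin m → Option U, (∏ i, μ (f i)) *
      ∑ g : Fin m' → Option V, ∏ j, ν (g j) = 1 := by
    have hν := sum_forall_prod_eq_pow ν (fun _ => True) m'
    have hμ := sum_forall_prod_eq_pow μ (fun _ => True) m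
    simp only [implies_true, if_true, hν1, hμ1, one_pow] at hν hμ
    simp only [hν, mul_one, hμ]
  rw [← hone, ← Finset.sum_add_distrib]
  refine Finset.sum_congr rfl fun f _ => ?_
  rw [Finset.mul_sum, Finset.mul_sum, ← Finset.sum_add_distrib]
  refine Finset.sum_congr rfl fun g _ => ?_
  by_cases h : ∃ (u : U) (v : V), E u v ∧ (∃ i, f i = some u) ∧ (∃ j, g j = some v)
  · rw [if_pos h, if_neg, mul_zero, add_zero]
    obtain ⟨u, v, he, hi, j, hj⟩ := h
    exact fun h' => h' j v hj ⟨u, Finset.mem_filter.2 ⟨Finset.mem_univ u, hi⟩, he⟩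
  · rw [if_neg h, if_pos, zero_add]
    rintro j v hj ⟨u, hu, he⟩
    exact h ⟨u, v, he, (Finset.mem_filter.1 hu).2, j, hj⟩

/-- Bipartite birthday paradox (Lemma 2.1): if every vertex cover of the bipartite
graph has total mass at least ε, then enough samples from each side find an edge
with probability at least 0.99. -/
theorem bipartite_birthday_paradox
    {U V : Type*} [Fintype U] [Fintype V]
    (E : U → V → Prop)
    (μ : Option U → ℝ) (ν : Option V → ℝ)
    (hμ0 : ∀ u, 0 ≤ μ u) (hμ1 : ∑ u, μ u = 1)
    (hν0 : ∀ v, 0 ≤ ν v) (hν1 : ∑ v, ν v = 1)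
    (ε : ℝ) (hε : 0 < ε)
    (hcover : ∀ (C₁ : Finset U) (C₂ : Finset V),
      (∀ u v, E u v → u ∈ C₁ ∨ v ∈ C₂) →
      ε ≤ ∑ u ∈ C₁, μ (some u) + ∑ v ∈ C₂, ν (some v))
    (m m' : ℕ) (hm : 0 < m) (hm' : 0 < m')
    (hmm' : 100 * (Fintype.card U : ℝ) / ε ^ 2 ≤ (m : ℝ) * (m' : ℝ))
    (hm2 : 100 / ε ≤ (m : ℝ)) (hm'2 : 100 / ε ≤ (m' : ℝ)) :
    0.99 ≤ ∑ f : Fin m → Option U, ∑ g : Fin m' → Option V,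
      (if ∃ (u : U) (v : V), E u v ∧ (∃ i, f i = some u) ∧ (∃ j, g j = some v)
       then (∏ i, μ (f i)) * (∏ j, ν (g j)) else 0) := by
  let g : Finset U → ℝ := fun T =>
    ∑ v ∈ Finset.univ.filter (fun v => ∃ u ∈ T, E u v), ν (some v)
  have hgsub : ∀ A B, g (A ∪ B) + g (A ∩ B) ≤ g A + g B := by
    intro A B
    simp only [g, Finset.sum_filter, ← Finset.sum_add_distrib]
    refine Finset.sum_le_sum fun v _ => ?_
    have hv := hν0 (some v)
    by_cases hA : ∃ u ∈ A, E u v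
    · have hAB : ∃ u ∈ A ∪ B, E u v :=
        let ⟨u, hu, he⟩ := hA; ⟨u, Finset.mem_union_left _ hu, he⟩
      rw [if_pos hA, if_pos hAB]
      refine add_le_add_right ?_ _
      by_cases hI : ∃ u ∈ A ∩ B, E u v
      · have hB : ∃ u ∈ B, E u v :=
          let ⟨u, hu, he⟩ := hI; ⟨u, Finset.mem_of_mem_inter_right hu, he⟩
        rw [if_pos hI, if_pos hB]
      · rw [if_neg hI]
        split_ifs <;> simp [hv]
    · have hI : ¬ ∃ u ∈ A ∩ B, E u v := fun ⟨u, hu, he⟩ =>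
        hA ⟨u, Finset.mem_of_mem_inter_left hu, he⟩
      rw [if_neg hA, if_neg hI, add_zero, zero_add]
      by_cases hB : ∃ u ∈ B, E u v
      · rw [if_pos hB]
        split_ifs <;> simp [hv]
      · rw [if_neg hB, if_neg]
        rintro ⟨u, hu, he⟩
        rcases Finset.mem_union.1 hu with h | h
        · exact hA ⟨u, h, he⟩
        · exact hB ⟨u, h, he⟩
  obtain ⟨p, hp0, hpμ, hpg, hpε⟩ := exists_le_of_submodular (fun u => μ (some u))
    (fun u => hμ0 _) g (by simp [g]) (fun T => Finset.sum_nonneg fun v _ => hν0 _) hgsub ε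
    (fun T => hcover _ _ fun u v he => by
      by_cases hu : u ∈ T
      · exact Or.inr (Finset.mem_filter.2 ⟨Finset.mem_univ v, u, hu, he⟩)
      · exact Or.inl (Finset.mem_compl.2 hu))
  have hmR : (0 : ℝ) < m := by exact_mod_cast hm
  have hmR' : (0 : ℝ) < m' := by exact_mod_cast hm'
  have hmp : ∀ k : ℝ, 0 < k → 100 / ε ≤ k → 100 ≤ k * ∑ u, p u := fun k hk h =>
    ((div_le_iff₀ hε).1 h).trans (mul_le_mul_of_nonneg_left hpε hk.le)
  have hmmp : 100 * (Fintype.card U : ℝ) ≤ m * m' * (∑ u, p u) ^ 2 :=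
    ((div_le_iff₀ (by positivity)).1 hmm').trans (by gcongr)
  have hnum : ∏ u, (1 - (1 - Real.exp (-(m' * p u))) * (1 - Real.exp (-(m * p u)))) ≤ 0.01 := by
    rcases le_total (m : ℝ) m' with h | h
    · simp_rw [mul_comm (1 - Real.exp (-((m' : ℝ) * p _)))]
      exact prod_one_sub_exp_mul_le p hp0 m m' hmR h (hmp m hmR hm2) hmmp
    · exact prod_one_sub_exp_mul_le p hp0 m' m hmR' h (hmp m' hmR' hm'2)
        (by rwa [mul_comm (m' : ℝ)])
  have hfail := (sum_mul_sum_no_edge_le E μ ν hμ0 hμ1 hν0 hν1 p hp0 hpμ hpg m m').trans hnum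
  have hadd := sum_edge_add_sum_no_edge E μ ν hμ1 hν1 m m'
  linarith
end

section
/- Let G = (V, E) be a finite k-uniform hypergraph (every edge e ∈ E is a k-element subset of V), let # be an element not in V, and let μ be a probability distribution on V ∪ {#}. Let ε > 0 and assume every vertex cover C of G satisfies μ(C) ≥ ε. Let S be the set formed by m independent samples from μ, where m is a positive integer with m ≥ 10·k²·|V|^{(k−1)/k}/ε. Then with probability at least 0.99, S contains an edge of G, i.e., there exists e ∈ E with e ⊆ S. -/
open scoped Classical

theorem sum_pi_prod_eq_one {ι α : Type*} [Fintype ι] [DecidableEq ι] [Fintype α] {μ : α → ℝ}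
    (hμ1 : ∑ a, μ a = 1) : ∑ f : ι → α, ∏ i, μ (f i) = 1 := by
  have h := Finset.prod_univ_sum (fun _ : ι => (Finset.univ : Finset α)) (fun _ => μ)
  simp only [hμ1, Finset.prod_const_one, Fintype.piFinset_univ] at h
  exact h.symm

/-- The probability that a finite i.i.d. sample avoids a set of mass at least `t`. -/
theorem sum_pi_avoid_le_exp {ι α : Type*} [Fintype ι] [DecidableEq ι] [Fintype α] [DecidableEq α] {μ : α → ℝ}
    (hμ0 : ∀ a, 0 ≤ μ a) (hμ1 : ∑ a, μ a = 1) (T : Finset α) {t : ℝ}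
    (ht : t ≤ ∑ a ∈ T, μ a) :
    ∑ f : ι → α, (∏ i, μ (f i)) * (if ∀ i, f i ∉ T then 1 else 0)
      ≤ Real.exp (-(Fintype.card ι * t)) := by
  have h := Finset.prod_univ_sum (fun _ : ι => Tᶜ) (fun _ => μ)
  have h2 : ∑ f : ι → α, (∏ i, μ (f i)) * (if ∀ i, f i ∉ T then 1 else 0)
      = ∑ f ∈ Fintype.piFinset (fun _ : ι => Tᶜ), ∏ i, μ (f i) := by
    simp only [mul_ite, mul_one, mul_zero]
    rw [← Finset.sum_filter]
    refine Finset.sum_congr ?_ fun _ _ => rfl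
    ext f
    simp
  rw [h2, ← h, Finset.prod_const, Finset.card_univ]
  have h3 : ∑ a ∈ Tᶜ, μ a ≤ Real.exp (-t) := by
    have := Finset.sum_add_sum_compl T μ
    have := Real.add_one_le_exp (-t)
    linarith
  calc _ ≤ Real.exp (-t) ^ Fintype.card ι :=
        pow_le_pow_left₀ (Finset.sum_nonneg fun a _ => hμ0 a) h3 _
    _ = _ := by rw [← Real.exp_nat_mul]; ring_nf

/-- Negative dependence of the occupancy indicators of one block of samples: label `e` is hit
when some sample equals `w e`, and `x` splits the mass of each point among its labels. -/
theorem sum_pi_prod_hit_le {ι α γ : Type*} [Fintype ι] [DecidableEq ι] [Fintype α] [DecidableEq α] {μ : α → ℝ}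
    (hμ0 : ∀ a, 0 ≤ μ a) (hμ1 : ∑ a, μ a = 1) (A : Finset γ) (w : γ → α) {x q : γ → ℝ}
    (hx : ∀ e ∈ A, 0 ≤ x e) (hq0 : ∀ e, 0 ≤ q e) (hq1 : ∀ e, q e ≤ 1)
    (hw : ∀ a, ∑ e ∈ A with w e = a, x e ≤ μ a) :
    ∑ f : ι → α, (∏ i, μ (f i)) * ∏ e ∈ A with ∃ i, f i = w e, q e
      ≤ ∏ e ∈ A, (1 - (1 - q e) * (1 - Real.exp (-(Fintype.card ι * x e)))) := by
  have key : ∀ f : ι → α, ∏ e ∈ A with ∃ i, f i = w e, q e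
      = ∑ M ∈ A.powerset, ((∏ e ∈ M, (1 - q e)) * ∏ e ∈ A \ M, q e)
          * (if ∀ i, f i ∉ M.image w then 1 else 0) := by
    intro f
    have h1 : ∏ e ∈ A with ∃ i, f i = w e, q e
        = ∏ e ∈ A, ((1 - q e) * (if ∃ i, f i = w e then 0 else 1) + q e) := by
      rw [Finset.prod_filter]
      refine Finset.prod_congr rfl fun e _ => ?_
      split_ifs <;> ring
    rw [h1, Finset.prod_add]
    refine Finset.sum_congr rfl fun M _ => ?_
    rw [Finset.prod_mul_distrib]
    have h2 : ∏ e ∈ M, (if ∃ i, f i = w e then (0 : ℝ) else 1)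
        = if ∀ i, f i ∉ M.image w then 1 else 0 := by
      split_ifs with h
      · refine Finset.prod_eq_one fun e he => if_neg ?_
        rintro ⟨i, hi⟩
        exact h i (Finset.mem_image.2 ⟨e, he, hi.symm⟩)
      · push Not at h
        obtain ⟨i, hi⟩ := h
        obtain ⟨e, he, hei⟩ := Finset.mem_image.1 hi
        exact Finset.prod_eq_zero he (if_pos ⟨i, hei.symm⟩)
    rw [h2]
    ring
  have hM : ∀ M ∈ A.powerset, ∑ e ∈ M, x e ≤ ∑ a ∈ M.image w, μ a := by
    intro M hMA
    rw [Finset.mem_powerset] at hMA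
    rw [← Finset.sum_fiberwise_of_maps_to (fun e he => Finset.mem_image_of_mem w he)]
    refine Finset.sum_le_sum fun a _ => (Finset.sum_le_sum_of_subset_of_nonneg ?_ ?_).trans (hw a)
    · exact Finset.filter_subset_filter _ hMA
    · intro e he _
      exact hx e (Finset.mem_filter.1 he).1
  calc _ = ∑ M ∈ A.powerset, ((∏ e ∈ M, (1 - q e)) * ∏ e ∈ A \ M, q e) *
          ∑ f : ι → α, (∏ i, μ (f i)) * (if ∀ i, f i ∉ M.image w then 1 else 0) := by
        simp only [key, Finset.mul_sum]
        rw [Finset.sum_comm]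
        refine Finset.sum_congr rfl fun M _ => Finset.sum_congr rfl fun f _ => ?_
        ring
    _ ≤ ∑ M ∈ A.powerset, ((∏ e ∈ M, (1 - q e)) * ∏ e ∈ A \ M, q e) *
          ∏ e ∈ M, Real.exp (-(Fintype.card ι * x e)) := by
        refine Finset.sum_le_sum fun M hMA => mul_le_mul_of_nonneg_left ?_ ?_
        · refine (sum_pi_avoid_le_exp hμ0 hμ1 _ (hM M hMA)).trans_eq ?_
          rw [← Real.exp_sum, Finset.mul_sum, Finset.sum_neg_distrib]
        · exact mul_nonneg (Finset.prod_nonneg fun e _ => sub_nonneg.2 (hq1 e))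
            (Finset.prod_nonneg fun e _ => hq0 e)
    _ = ∏ e ∈ A, ((1 - q e) * Real.exp (-(Fintype.card ι * x e)) + q e) := by
        rw [Finset.prod_add]
        refine Finset.sum_congr rfl fun M _ => ?_
        rw [Finset.prod_mul_distrib]
        ring
    _ = _ := Finset.prod_congr rfl fun e _ => by ring

/-- The probability that no label is hit in each of `t` independent blocks of samples. -/
theorem sum_pi_blocks_le {ι α γ : Type*} [Fintype ι] [DecidableEq ι] [Fintype α] [DecidableEq α] {μ : α → ℝ}
    (hμ0 : ∀ a, 0 ≤ μ a) (hμ1 : ∑ a, μ a = 1) {x : γ → ℝ} {t : ℕ}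
    (w : Fin t → γ → α) (A : Finset γ) (hx : ∀ e, 0 ≤ x e)
    (hw : ∀ j a, ∑ e ∈ A with w j e = a, x e ≤ μ a) :
    ∑ B : Fin t → ι → α, (∏ j, ∏ i, μ (B j i)) *
        ∏ _e ∈ A with ∀ j, ∃ i, B j i = w j _e, (0 : ℝ)
      ≤ ∏ e ∈ A, (1 - (1 - Real.exp (-(Fintype.card ι * x e))) ^ t) := by
  induction t generalizing A with
  | zero => simp
  | succ t ih =>
    have hp0 : ∀ e, 0 ≤ 1 - Real.exp (-(Fintype.card ι * x e)) := fun e => by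
      rw [sub_nonneg, Real.exp_le_one_iff, neg_nonpos]
      exact mul_nonneg (Nat.cast_nonneg _) (hx e)
    have hp1 : ∀ e, 1 - Real.exp (-(Fintype.card ι * x e)) ≤ 1 := fun e => by
      have := Real.exp_pos (-(Fintype.card ι * x e))
      linarith
    rw [← (Fin.consEquiv (fun _ : Fin (t + 1) => ι → α)).sum_comp, Fintype.sum_prod_type]
    calc _ = ∑ b : ι → α, (∏ i, μ (b i)) * ∑ B : Fin t → ι → α, (∏ j, ∏ i, μ (B j i)) *
          ∏ _e ∈ A.filter (fun e => ∃ i, b i = w 0 e) with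
            ∀ j, ∃ i, B j i = w (Fin.succ j) _e, (0 : ℝ) := by
          refine Finset.sum_congr rfl fun b _ => ?_
          rw [Finset.mul_sum]
          refine Finset.sum_congr rfl fun B _ => ?_
          simp only [Fin.consEquiv, Equiv.coe_fn_mk, Fin.prod_univ_succ, Fin.cons_zero,
            Fin.cons_succ, Fin.forall_fin_succ, Finset.filter_filter, mul_assoc]
      _ ≤ ∑ b : ι → α, (∏ i, μ (b i)) * ∏ e ∈ A with ∃ i, b i = w 0 e,
            (1 - (1 - Real.exp (-(Fintype.card ι * x e))) ^ t) := by
          refine Finset.sum_le_sum fun b _ => mul_le_mul_of_nonneg_left ?_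
            (Finset.prod_nonneg fun i _ => hμ0 _)
          refine ih (fun j => w j.succ) _ fun j a => le_trans ?_ (hw j.succ a)
          refine Finset.sum_le_sum_of_subset_of_nonneg ?_ fun e _ _ => hx e
          exact Finset.filter_subset_filter _ (Finset.filter_subset _ _)
      _ ≤ _ := by
          refine (sum_pi_prod_hit_le hμ0 hμ1 A (w 0) (fun e _ => hx e)
            (fun e => sub_nonneg.2 (pow_le_one₀ (hp0 e) (hp1 e)))
            (fun e => sub_le_self _ (pow_nonneg (hp0 e) _)) (hw 0)).trans_eq ?_
          refine Finset.prod_congr rfl fun e _ => ?_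
          ring

/-- A maximal fractional packing of edges, together with a vertex cover of saturated vertices. -/
theorem exists_packing_saturated_cover {V : Type*} [DecidableEq V] (E : Finset (Finset V))
    (hE : ∀ e ∈ E, e.Nonempty) {μ : V → ℝ} (hμ0 : ∀ v, 0 ≤ μ v) :
    ∃ (F : Finset (Finset V)) (T : Finset V) (x : Finset V → ℝ), F ⊆ E ∧ (∀ e, 0 ≤ x e) ∧
      F.card ≤ T.card ∧ (∀ e ∈ E, ∃ v ∈ e, v ∈ T) ∧
      (∀ v, ∑ e ∈ F with v ∈ e, x e ≤ μ v) ∧ (∀ v ∈ T, ∑ e ∈ F with v ∈ e, x e = μ v) := by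
  induction E using Finset.induction_on with
  | empty => exact ⟨∅, ∅, 0, by simp, by simp, by simp, by simp, by simpa using hμ0, by simp⟩
  | insert e₀ E he₀ ih =>
    obtain ⟨F, T, x, hF, hx, hc, hT, hle, heq⟩ := ih fun e he => hE e (Finset.mem_insert_of_mem he)
    by_cases hm : ∃ v ∈ e₀, v ∈ T
    · refine ⟨F, T, x, hF.trans (Finset.subset_insert _ _), hx, hc, ?_, hle, heq⟩
      intro e he
      rcases Finset.mem_insert.1 he with rfl | he
      exacts [hm, hT e he]
    · have heF : e₀ ∉ F := fun h => he₀ (hF h)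
      obtain ⟨v₀, hv₀, hmin⟩ := Finset.exists_min_image e₀
        (fun v => μ v - ∑ e ∈ F with v ∈ e, x e) (hE e₀ (Finset.mem_insert_self _ _))
      set r : ℝ := μ v₀ - ∑ e ∈ F with v₀ ∈ e, x e with hr
      have hold : ∀ v, ∑ e ∈ F with v ∈ e, Function.update x e₀ r e = ∑ e ∈ F with v ∈ e, x e := by
        intro v
        refine Finset.sum_congr rfl fun e he => Function.update_of_ne ?_ _ _
        rintro rfl
        exact heF (Finset.mem_filter.1 he).1
      have hin : ∀ v ∈ e₀, ∑ e ∈ insert e₀ F with v ∈ e, Function.update x e₀ r e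
          = r + ∑ e ∈ F with v ∈ e, x e := by
        intro v hv
        rw [Finset.filter_insert, if_pos hv, Finset.sum_insert (by simp [heF]), hold,
          Function.update_self]
      have hout : ∀ v ∉ e₀, ∑ e ∈ insert e₀ F with v ∈ e, Function.update x e₀ r e
          = ∑ e ∈ F with v ∈ e, x e := by
        intro v hv
        rw [Finset.filter_insert, if_neg hv, hold]
      refine ⟨insert e₀ F, insert v₀ T, Function.update x e₀ r, Finset.insert_subset_insert _ hF,
        ?_, ?_, ?_, ?_, ?_⟩
      · intro e
        by_cases h : e = e₀
        · subst h
          rw [Function.update_self]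
          exact sub_nonneg.2 (hle v₀)
        · rw [Function.update_of_ne h]
          exact hx e
      · rw [Finset.card_insert_of_notMem heF,
          Finset.card_insert_of_notMem fun h => hm ⟨v₀, hv₀, h⟩]
        omega
      · intro e he
        rcases Finset.mem_insert.1 he with rfl | he
        · exact ⟨v₀, hv₀, Finset.mem_insert_self _ _⟩
        · obtain ⟨v, hv, hvT⟩ := hT e he
          exact ⟨v, hv, Finset.mem_insert_of_mem hvT⟩
      · intro v
        by_cases hv : v ∈ e₀
        · rw [hin v hv]
          linarith [hmin v hv]
        · rw [hout v hv]
          exact hle v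
      · intro v hv
        rcases Finset.mem_insert.1 hv with rfl | hv
        · rw [hin v hv₀]
          linarith
        · rw [hout v fun h => hm ⟨v, h, hv⟩]
          exact heq v hv

/-- Ignoring all samples except those indexed by a `t × s` grid. -/
theorem sum_pi_grid_eq {α : Type*} [Fintype α] {μ : α → ℝ} (hμ1 : ∑ a, μ a = 1) {m t s r : ℕ}
    (g : (Fin t × Fin s) ⊕ Fin r ≃ Fin m) (H : (Fin t → Fin s → α) → ℝ) :
    ∑ f : Fin m → α, (∏ i, μ (f i)) * H (fun j i => f (g (Sum.inl (j, i))))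
      = ∑ B : Fin t → Fin s → α, (∏ j, ∏ i, μ (B j i)) * H B := by
  rw [← (Equiv.arrowCongr g (Equiv.refl α)).sum_comp,
    ← (Equiv.sumArrowEquivProdArrow (Fin t × Fin s) (Fin r) α).symm.sum_comp,
    Fintype.sum_prod_type, ← (Equiv.curry (Fin t) (Fin s) α).sum_comp]
  refine Finset.sum_congr rfl fun h _ => ?_
  have h1 : ∀ f : Fin r → α, ∏ i, μ ((Equiv.arrowCongr g (Equiv.refl α)
      ((Equiv.sumArrowEquivProdArrow (Fin t × Fin s) (Fin r) α).symm (h, f))) i)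
      = (∏ j, ∏ i, μ (h (j, i))) * ∏ i, μ (f i) := by
    intro f
    rw [← g.prod_comp, Fintype.prod_sum_type, Fintype.prod_prod_type]
    simp [Equiv.sumArrowEquivProdArrow]
  simp only [h1]
  simp only [Equiv.arrowCongr_apply, Equiv.coe_refl, Function.comp_apply, Equiv.symm_apply_apply,
    id, Equiv.sumArrowEquivProdArrow_symm_apply_inl, Equiv.curry_apply, Function.curry]
  rw [← Finset.sum_mul, ← Finset.mul_sum, sum_pi_prod_eq_one hμ1, mul_one]
  rfl

theorem exp_neg_five_le : Real.exp (-5) ≤ 0.01 := by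
  have h1 : (2.7 : ℝ) ≤ Real.exp 1 := by linarith [Real.exp_one_gt_d9]
  have h2 : Real.exp 5 = Real.exp 1 ^ 5 := by rw [← Real.exp_nat_mul]; norm_num
  have h3 : (100 : ℝ) ≤ Real.exp 5 := by
    rw [h2]
    refine le_trans ?_ (pow_le_pow_left₀ (by norm_num) h1 5)
    norm_num
  rw [Real.exp_neg]
  refine (inv_anti₀ (by norm_num) h3).trans ?_
  norm_num

theorem log_hundred_mul_le {k : ℕ} (hk : 2 ≤ k) : Real.log (100 * k) ≤ 3 * k := by
  have hk' : (2 : ℝ) ≤ k := by exact_mod_cast hk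
  have h1 : Real.log 100 ≤ 5 := by
    rw [Real.log_le_iff_le_exp (by norm_num)]
    have h := exp_neg_five_le
    rw [Real.exp_neg] at h
    have h2 := inv_anti₀ (by positivity) h
    rw [inv_inv] at h2
    refine le_trans ?_ h2
    norm_num
  have h2 := Real.log_le_sub_one_of_pos (show (0 : ℝ) < k by linarith)
  rw [Real.log_mul (by norm_num) (by linarith)]
  linarith

theorem quarter_le_one_sub_exp_neg {a : ℝ} (ha0 : 0 ≤ a) (ha3 : a ≤ 3) :
    a / 4 ≤ 1 - Real.exp (-a) := by
  have h1 : Real.exp (-a) ≤ (1 + a)⁻¹ := by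
    rw [Real.exp_neg]
    exact inv_anti₀ (by linarith) (by linarith [Real.add_one_le_exp a])
  have h2 : (1 + a)⁻¹ ≤ 1 - a / 4 := by
    rw [inv_le_iff_one_le_mul₀ (by linarith)]
    nlinarith
  linarith

/-- If every edge of a packing is light, the expected number of complete edges is large enough
to make the product bound on the failure probability small. -/
theorem prod_one_sub_hit_pow_le {γ : Type*} (F : Finset γ) {x : γ → ℝ} (hx : ∀ e, 0 ≤ x e)
    {k n m : ℕ} (hk : 0 < k) (hn : 0 < n) (hF : F.card ≤ n) {ε : ℝ} (hε : 0 < ε) (hε1 : ε ≤ 1)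
    (hεx : ε ≤ k * ∑ e ∈ F, x e)
    (hm : 10 * (k : ℝ) ^ 2 * (n : ℝ) ^ (((k : ℝ) - 1) / (k : ℝ)) / ε ≤ (m : ℝ))
    (hlight : ∀ e ∈ F, m * x e ≤ Real.log (100 * k)) :
    ∏ e ∈ F, (1 - (1 - Real.exp (-((m / k : ℕ) * x e))) ^ k) ≤ 0.01 := by
  rcases Nat.lt_or_ge k 2 with h1 | h2
  · obtain rfl : k = 1 := by omega
    simp only [Nat.div_one, pow_one, sub_sub_cancel, Nat.cast_one, sub_self, zero_div,
      Real.rpow_zero, one_mul, one_pow, mul_one] at *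
    rw [← Real.exp_sum, Finset.sum_neg_distrib, ← Finset.mul_sum]
    rw [div_le_iff₀ hε] at hm
    have : (m : ℝ) * ε ≤ m * ∑ e ∈ F, x e := mul_le_mul_of_nonneg_left hεx (Nat.cast_nonneg _)
    exact (Real.exp_le_exp.2 (by linarith)).trans exp_neg_five_le
  · have hk0 : (0 : ℝ) < k := by exact_mod_cast hk
    have hk1 : (1 : ℝ) ≤ k := by exact_mod_cast hk
    set N : ℝ := (n : ℝ) ^ (((k : ℝ) - 1) / (k : ℝ)) with hN
    have hN1 : 1 ≤ N := Real.one_le_rpow (by exact_mod_cast hn)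
      (div_nonneg (by linarith) hk0.le)
    have hNk : N ^ k = (n : ℝ) ^ (k - 1) := by
      rw [hN, ← Real.rpow_mul_natCast (Nat.cast_nonneg _), div_mul_cancel₀ _ hk0.ne',
        ← Nat.cast_one, ← Nat.cast_sub hk, Real.rpow_natCast]
    set s : ℕ := m / k with hs
    have hsk : (k : ℝ) * s ≤ m := by exact_mod_cast Nat.mul_div_le m k
    have hms : (m : ℝ) ≤ k * (s + 1) := by
      exact_mod_cast (Nat.lt_mul_div_succ m hk).le
    have hslow : 9 * k * N ≤ s * ε := by
      rw [div_le_iff₀ hε] at hm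
      have h3 : (k : ℝ) * (10 * k * N) ≤ k * ((s + 1) * ε) := by nlinarith
      have h4 := le_of_mul_le_mul_left h3 hk0
      have h5 : 1 ≤ k * N := one_le_mul_of_one_le_of_one_le hk1 hN1
      nlinarith
    have hlog := log_hundred_mul_le h2
    have ha0 : ∀ e, 0 ≤ (s : ℝ) * x e := fun e => mul_nonneg (Nat.cast_nonneg _) (hx e)
    have ha3 : ∀ e ∈ F, (s : ℝ) * x e ≤ 3 := fun e he => by
      have h3 : (k : ℝ) * (s * x e) ≤ k * 3 := by
        have := mul_le_mul_of_nonneg_right hsk (hx e)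
        linarith [hlight e he]
      exact le_of_mul_le_mul_left h3 hk0
    have hsum : 9 / 4 * N ≤ ∑ e ∈ F, s * x e / 4 := by
      rw [← Finset.sum_div, ← Finset.mul_sum]
      have h3 : (k : ℝ) * (9 * N) ≤ k * (s * ∑ e ∈ F, x e) := by
        have := mul_le_mul_of_nonneg_left hεx (Nat.cast_nonneg (α := ℝ) s)
        linarith
      have h4 := le_of_mul_le_mul_left h3 hk0
      linarith
    have hFne : 0 < F.card := by
      rw [Finset.card_pos]
      by_contra h
      rw [Finset.not_nonempty_iff_eq_empty] at h
      subst h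
      simp at hsum
      linarith
    have hpow : 5 ≤ ∑ e ∈ F, (s * x e / 4) ^ k := by
      obtain ⟨j, rfl⟩ : ∃ j, k = j + 1 := ⟨k - 1, by omega⟩
      refine le_trans ?_ (pow_sum_div_card_le_sum_pow
        (fun e _ => div_nonneg (ha0 e) (by norm_num)) j)
      rw [le_div_iff₀ (by positivity)]
      refine le_trans ?_ (pow_le_pow_left₀ (by positivity) hsum _)
      rw [mul_pow, hNk, Nat.add_sub_cancel]
      refine mul_le_mul ?_ ?_ (by positivity) (by positivity)
      · refine le_trans ?_ (pow_le_pow_right₀ (by norm_num) h2)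
        norm_num
      · exact pow_le_pow_left₀ (Nat.cast_nonneg _) (by exact_mod_cast hF) _
    calc _ ≤ ∏ e ∈ F, Real.exp (-(s * x e / 4) ^ k) := by
          refine Finset.prod_le_prod (fun e _ => ?_) fun e he => ?_
          · refine sub_nonneg.2 (pow_le_one₀ ?_ ?_)
            · rw [sub_nonneg, Real.exp_le_one_iff, neg_nonpos]
              exact ha0 e
            · linarith [Real.exp_pos (-((s : ℝ) * x e))]
          · have h3 := pow_le_pow_left₀ (div_nonneg (ha0 e) (by norm_num))
              (quarter_le_one_sub_exp_neg (ha0 e) (ha3 e he)) k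
            linarith [Real.add_one_le_exp (-(s * x e / 4) ^ k)]
      _ = Real.exp (-∑ e ∈ F, (s * x e / 4) ^ k) := by
          rw [← Real.exp_sum, Finset.sum_neg_distrib]
      _ ≤ _ := (Real.exp_le_exp.2 (by linarith)).trans exp_neg_five_le

/-- The probability that a sample does not contain a fixed set of heavy points. -/
theorem sum_pi_not_subset_le {V : Type*} [Fintype V] [DecidableEq V] {μ : Option V → ℝ}
    (hμ0 : ∀ a, 0 ≤ μ a) (hμ1 : ∑ a, μ a = 1) (e : Finset V) {t : ℝ}
    (ht : ∀ v ∈ e, t ≤ μ (some v)) (m : ℕ) :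
    ∑ f : Fin m → Option V, (∏ i, μ (f i)) * (if ∀ v ∈ e, ∃ i, f i = some v then 0 else 1)
      ≤ e.card * Real.exp (-(m * t)) := by
  calc _ ≤ ∑ f : Fin m → Option V, (∏ i, μ (f i)) *
          ∑ v ∈ e, (if ∀ i, f i ∉ ({some v} : Finset (Option V)) then (1 : ℝ) else 0) := by
        refine Finset.sum_le_sum fun f _ => mul_le_mul_of_nonneg_left ?_
          (Finset.prod_nonneg fun i _ => hμ0 _)
        have h0 : ∀ v ∈ e, (0 : ℝ) ≤
            if ∀ i, f i ∉ ({some v} : Finset (Option V)) then (1 : ℝ) else 0 :=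
          fun v _ => by split_ifs <;> norm_num
        split_ifs with h
        · exact Finset.sum_nonneg h0
        · push Not at h
          obtain ⟨v, hv, hvf⟩ := h
          refine le_trans (le_of_eq ?_) (Finset.single_le_sum h0 hv)
          rw [if_pos]
          simpa using hvf
    _ = ∑ v ∈ e, ∑ f : Fin m → Option V, (∏ i, μ (f i)) *
          (if ∀ i, f i ∉ ({some v} : Finset (Option V)) then (1 : ℝ) else 0) := by
        simp only [Finset.mul_sum]
        exact Finset.sum_comm
    _ ≤ ∑ _v ∈ e, Real.exp (-(m * t)) := by
        refine Finset.sum_le_sum fun v hv => ?_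
        have := sum_pi_avoid_le_exp (ι := Fin m) hμ0 hμ1 {some v} (t := t) (by simpa using ht v hv)
        rw [Fintype.card_fin] at this
        refine le_trans (le_of_eq ?_) this
        congr!
    _ = _ := by rw [Finset.sum_const, nsmul_eq_mul]

/-- The probability that a sample contains no edge of a fractional packing of `k`-sets. -/
theorem sum_pi_no_edge_le {V : Type*} [Fintype V] [DecidableEq V] {μ : Option V → ℝ}
    (hμ0 : ∀ a, 0 ≤ μ a) (hμ1 : ∑ a, μ a = 1) (F : Finset (Finset V)) {k : ℕ}
    (hF : ∀ e ∈ F, e.card = k) {x : Finset V → ℝ} (hx : ∀ e, 0 ≤ x e)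
    (hle : ∀ v, ∑ e ∈ F with v ∈ e, x e ≤ μ (some v)) (m : ℕ) :
    ∑ f : Fin m → Option V, (∏ i, μ (f i)) *
        (if ∃ e ∈ F, ∀ v ∈ e, ∃ i, f i = some v then 0 else 1)
      ≤ ∏ e ∈ F, (1 - (1 - Real.exp (-((m / k : ℕ) * x e))) ^ k) := by
  have hlab : ∀ e : Finset V, ∃ l : Fin k → Option V, e ∈ F →
      (∀ j, ∃ v ∈ e, l j = some v) ∧ ∀ v ∈ e, ∃ j, l j = some v := by
    intro e
    by_cases he : e ∈ F
    · let φ := e.equivFinOfCardEq (hF e he)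
      refine ⟨fun j => some (φ.symm j : V), fun _ => ⟨fun j => ⟨_, (φ.symm j).2, rfl⟩, ?_⟩⟩
      intro v hv
      exact ⟨φ ⟨v, hv⟩, by simp⟩
    · exact ⟨fun _ => none, fun h => absurd h he⟩
  choose l hl using hlab
  have hcard : Fintype.card ((Fin k × Fin (m / k)) ⊕ Fin (m % k)) = Fintype.card (Fin m) := by
    simp [Nat.div_add_mod]
  let g := Fintype.equivOfCardEq hcard
  have hblocks := sum_pi_blocks_le (ι := Fin (m / k)) hμ0 hμ1 (fun j e => l e j) F hx (by
    intro j a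
    cases a with
    | none =>
      refine (Finset.sum_eq_zero fun e he => ?_).trans_le (hμ0 _)
      obtain ⟨he, h⟩ := Finset.mem_filter.1 he
      obtain ⟨v, -, hv⟩ := (hl e he).1 j
      simp [hv] at h
    | some v =>
      refine le_trans (Finset.sum_le_sum_of_subset_of_nonneg ?_ fun e _ _ => hx e) (hle v)
      intro e he
      obtain ⟨he, h⟩ := Finset.mem_filter.1 he
      obtain ⟨u, hu, huv⟩ := (hl e he).1 j
      rw [h, Option.some_inj] at huv
      exact Finset.mem_filter.2 ⟨he, huv ▸ hu⟩)
  rw [← sum_pi_grid_eq hμ1 g, Fintype.card_fin] at hblocks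
  refine le_trans (Finset.sum_le_sum fun f _ => mul_le_mul_of_nonneg_left ?_
    (Finset.prod_nonneg fun i _ => hμ0 _)) hblocks
  split_ifs with h
  · exact Finset.prod_nonneg fun _ _ => le_rfl
  · refine (Finset.prod_eq_one fun e he => absurd ?_ h).ge
    simp only [Finset.mem_filter] at he
    obtain ⟨he, hall⟩ := he
    refine ⟨e, he, fun v hv => ?_⟩
    obtain ⟨j, hj⟩ := (hl e he).2 v hv
    obtain ⟨i, hi⟩ := hall j
    exact ⟨_, hi.trans hj⟩

/-- Hypergraph birthday paradox (Lemma 2.2): if every vertex cover of a k-uniform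
hypergraph has mass at least ε, then m ≥ 10k²|V|^{(k-1)/k}/ε samples contain an edge
with probability at least 0.99. -/
theorem hypergraph_birthday_paradox
    {V : Type*} [Fintype V] [DecidableEq V]
    (k : ℕ) (hk : 0 < k)
    (E : Finset (Finset V)) (hE : ∀ e ∈ E, e.card = k)
    (μ : Option V → ℝ) (hμ0 : ∀ v, 0 ≤ μ v) (hμ1 : ∑ v, μ v = 1)
    (ε : ℝ) (hε : 0 < ε)
    (hcover : ∀ C : Finset V, (∀ e ∈ E, ∃ v ∈ e, v ∈ C) → ε ≤ ∑ v ∈ C, μ (some v))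
    (m : ℕ) (hm : 0 < m)
    (hm2 : 10 * (k : ℝ) ^ 2 * (Fintype.card V : ℝ) ^ (((k : ℝ) - 1) / (k : ℝ)) / ε ≤ (m : ℝ)) :
    0.99 ≤ ∑ f : Fin m → Option V,
      (if ∃ e ∈ E, ∀ v ∈ e, ∃ i, f i = some v
       then ∏ i, μ (f i) else 0) := by
  obtain ⟨F, T, x, hFE, hx, hFT, hT, hle, heq⟩ := exists_packing_saturated_cover E
    (fun e he => Finset.card_pos.1 ((hE e he).symm ▸ hk)) (μ := fun v => μ (some v))
    (fun v => hμ0 _)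
  have hεT := hcover T hT
  have hε1 : ε ≤ 1 := by
    rw [Fintype.sum_option] at hμ1
    have : ∑ v ∈ T, μ (some v) ≤ ∑ v, μ (some v) :=
      Finset.sum_le_sum_of_subset_of_nonneg (Finset.subset_univ _) fun v _ _ => hμ0 _
    linarith [hμ0 none]
  have hεx : ε ≤ k * ∑ e ∈ F, x e := by
    calc ε ≤ ∑ v ∈ T, ∑ e ∈ F with v ∈ e, x e :=
          hεT.trans_eq (Finset.sum_congr rfl fun v hv => (heq v hv).symm)
      _ ≤ ∑ v, ∑ e ∈ F with v ∈ e, x e :=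
          Finset.sum_le_sum_of_subset_of_nonneg (Finset.subset_univ _) fun v _ _ =>
            Finset.sum_nonneg fun e _ => hx e
      _ = ∑ e ∈ F, ∑ _v ∈ e, x e := Finset.sum_comm' (by simp [and_comm])
      _ = k * ∑ e ∈ F, x e := by
          rw [Finset.mul_sum]
          refine Finset.sum_congr rfl fun e he => ?_
          rw [Finset.sum_const, hE e (hFE he), nsmul_eq_mul]
  have hn : 0 < Fintype.card V := by
    rcases T.eq_empty_or_nonempty with rfl | ⟨v, -⟩
    · simp at hεT
      linarith
    · exact Fintype.card_pos_iff.2 ⟨v⟩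
  have hfail : ∑ f : Fin m → Option V, (∏ i, μ (f i)) *
      (if ∃ e ∈ F, ∀ v ∈ e, ∃ i, f i = some v then 0 else 1) ≤ 0.01 := by
    by_cases hheavy : ∃ e ∈ F, Real.log (100 * k) ≤ m * x e
    · obtain ⟨e, he, hlog⟩ := hheavy
      have hxe : ∀ v ∈ e, x e ≤ μ (some v) := fun v hv => le_trans
        (Finset.single_le_sum (f := x) (fun e _ => hx e) (Finset.mem_filter.2 ⟨he, hv⟩)) (hle v)
      refine le_trans (Finset.sum_le_sum fun f _ => mul_le_mul_of_nonneg_left ?_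
        (Finset.prod_nonneg fun i _ => hμ0 _)) ((sum_pi_not_subset_le hμ0 hμ1 e hxe m).trans ?_)
      · split_ifs with h1 h2 h2
        · rfl
        · norm_num
        · exact absurd ⟨e, he, h2⟩ h1
        · rfl
      · have hk0 : (0 : ℝ) < k := by exact_mod_cast hk
        rw [hE e (hFE he)]
        calc (k : ℝ) * Real.exp (-(m * x e)) ≤ k * Real.exp (-Real.log (100 * k)) := by gcongr
          _ = 0.01 := by
            rw [Real.exp_neg, Real.exp_log (by positivity)]
            field_simp
            norm_num
    · push Not at hheavy
      exact (sum_pi_no_edge_le hμ0 hμ1 F (fun e he => hE e (hFE he)) hx hle m).trans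
        (prod_one_sub_hit_pow_le F hx hk hn (hFT.trans (Finset.card_le_univ _)) hε hε1 hεx hm2
          fun e he => (hheavy e he).le)
  have hone := sum_pi_prod_eq_one (ι := Fin m) hμ1
  have hsplit : ∑ f : Fin m → Option V, ∏ i, μ (f i) ≤ ∑ f : Fin m → Option V,
      ((if ∃ e ∈ E, ∀ v ∈ e, ∃ i, f i = some v then ∏ i, μ (f i) else 0) + (∏ i, μ (f i)) *
      (if ∃ e ∈ F, ∀ v ∈ e, ∃ i, f i = some v then 0 else 1)) := by
    refine Finset.sum_le_sum fun f _ => ?_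
    have h0 : 0 ≤ ∏ i, μ (f i) := Finset.prod_nonneg fun i _ => hμ0 _
    split_ifs with h1 h2 h2
    · simp
    · linarith
    · obtain ⟨e, he, h⟩ := h2
      exact absurd ⟨e, hFE he, h⟩ h1
    · simp
  rw [Finset.sum_add_distrib, hone] at hsplit
  linarith
end

section
/- Let <_σ be a comparison function on [n] and let 𝒟 be a probability distribution over the 2-element subsets of [n]. Suppose <_σ is ε-far from total orderings with respect to 𝒟. Then every feedback edge set R of the order graph G_σ (a set R of directed edges of G_σ such that removing R from G_σ leaves an acyclic digraph) satisfies 𝒟(R) ≥ ε, where 𝒟(R) = Σ_{(u,v)∈R} 𝒟({u,v}). -/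
open scoped Classical

/-- Every acyclic relation is contained in a strict total order. -/
theorem exists_isStrictTotalOrder_of_acyclic {α : Type*} (r : α → α → Prop)
    (hr : ∀ a, ¬ Relation.TransGen r a a) :
    ∃ t : α → α → Prop, IsStrictTotalOrder α t ∧ ∀ a b, r a b → t a b := by
  have : IsPartialOrder α (Relation.ReflTransGen r) :=
    { refl := fun _ => .refl
      trans := fun _ _ _ => .trans
      antisymm := fun a b hab hba => by
        rcases Relation.reflTransGen_iff_eq_or_transGen.1 hab with h | h
        · exact h.symm
        · exact (hr a (h.trans_left hba)).elim }
  obtain ⟨s, hs, hrs⟩ := extend_partialOrder (Relation.ReflTransGen r)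
  refine ⟨fun a b => s a b ∧ a ≠ b, ?_, fun a b h => ⟨hrs a b (.single h), ?_⟩⟩
  · exact
      { irrefl := fun a h => h.2 rfl
        trans := fun a b c hab hbc => ⟨hs.trans _ _ _ hab.1 hbc.1, by
          rintro rfl
          exact hab.2 (hs.antisymm _ _ hab.1 hbc.1)⟩
        trichotomous := fun a b hab hba => by
          by_contra hne
          rcases hs.total a b with h | h
          · exact hab ⟨h, hne⟩
          · exact hba ⟨h, Ne.symm hne⟩ }
  · rintro rfl
    exact hr a (.single h)

/-- Lemma 3.5: if a comparison function (tournament) σ on [n] is ε-far from total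
orderings with respect to 𝒟, then every feedback edge set R of the order graph G_σ
satisfies 𝒟(R) ≥ ε. -/
theorem feedback_edge_set_mass
    (n : ℕ) (σ : Fin n → Fin n → Prop)
    (hirr : ∀ u, ¬ σ u u)
    (htour : ∀ u v : Fin n, u ≠ v → (σ u v ↔ ¬ σ v u))
    (D : Sym2 (Fin n) → ℝ)
    (hD0 : ∀ p, 0 ≤ D p) (hD1 : ∑ p, D p = 1)
    (hDdiag : ∀ p : Sym2 (Fin n), p.IsDiag → D p = 0)
    (ε : ℝ)
    (hfar : ∀ τ : Fin n → Fin n → Prop, IsStrictTotalOrder (Fin n) τ →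
      ε ≤ ∑ p : Sym2 (Fin n),
        (if ∃ u v : Fin n, p = s(u, v) ∧ σ u v ∧ τ v u then D p else 0))
    (R : Finset (Fin n × Fin n))
    (hR : ∀ e ∈ R, σ e.1 e.2)
    (hacyc : ∀ u : Fin n, ¬ Relation.TransGen (fun a b => σ a b ∧ (a, b) ∉ R) u u) :
    ε ≤ ∑ e ∈ R, D s(e.1, e.2) := by
  obtain ⟨τ, hτ, hsub⟩ := exists_isStrictTotalOrder_of_acyclic _ hacyc
  refine (hfar τ hτ).trans ?_
  rw [← Finset.sum_fiberwise R (fun e => s(e.1, e.2))]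
  refine Finset.sum_le_sum fun p _ => ?_
  split_ifs with h
  · obtain ⟨u, v, rfl, huv, hvu⟩ := h
    have hmem : (u, v) ∈ R := by
      by_contra hnot
      exact hτ.irrefl u (hτ.trans _ _ _ (hsub u v ⟨huv, hnot⟩) hvu)
    exact Finset.single_le_sum (f := fun e : Fin n × Fin n => D s(e.1, e.2))
      (fun e _ => hD0 _) (show (u, v) ∈ R.filter (fun e => s(e.1, e.2) = s(u, v)) by simp [hmem])
  · exact Finset.sum_nonneg fun e _ => hD0 _
end

section
/- Let 𝒟 be a probability distribution over a finite ground set B, and let T ⊆ B be a subset such that 𝒟(T) ≥ ε and 𝒟({t}) ≥ p for every element t ∈ T, where ε, p > 0. Let X₁, …, X_m be m independent samples from 𝒟 and let S = {X₁, …, X_m}. Then Pr[𝒟(S ∩ T) ≤ min{ε·p·m/4, ε/2}] ≤ e^{−ε·m/16}. -/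
open scoped Classical

/-- If a set function `g` shrinks on average by a factor `r` whenever a random element is inserted,
then its expected value at the set of `m` independent samples is at most `r ^ m * g ∅`. -/
theorem sum_prod_mul_image_le {B : Type*} [Fintype B] [DecidableEq B]
    (D : B → ℝ) (hD0 : ∀ b, 0 ≤ D b) (g : Finset B → ℝ) (r : ℝ) (hr : 0 ≤ r)
    (hg : ∀ S, ∑ b, D b * g (insert b S) ≤ r * g S) (m : ℕ) :
    ∑ X : Fin m → B, (∏ i, D (X i)) * g (Finset.image X Finset.univ) ≤ r ^ m * g ∅ := by
  induction m with
  | zero => simp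
  | succ m ih =>
    have image_cons (b : B) (X : Fin m → B) :
        Finset.image (Fin.cons b X : Fin (m + 1) → B) Finset.univ
          = insert b (Finset.image X Finset.univ) := by
      ext x
      simp [Fin.exists_fin_succ, eq_comm]
    calc ∑ X : Fin (m + 1) → B, (∏ i, D (X i)) * g (Finset.image X Finset.univ)
        = ∑ x : B × (Fin m → B), (D x.1 * ∏ i, D (x.2 i)) *
            g (insert x.1 (Finset.image x.2 Finset.univ)) := by
          refine (Fintype.sum_equiv (Fin.consEquiv fun _ => B) _ _ fun x => ?_).symm
          simp [Fin.consEquiv, Fin.prod_univ_succ, image_cons]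
      _ = ∑ X : Fin m → B, (∏ i, D (X i)) *
            ∑ b, D b * g (insert b (Finset.image X Finset.univ)) := by
          rw [Fintype.sum_prod_type_right]
          refine Finset.sum_congr rfl fun X _ => ?_
          rw [Finset.mul_sum]
          exact Finset.sum_congr rfl fun b _ => by ring
      _ ≤ ∑ X : Fin m → B, (∏ i, D (X i)) * (r * g (Finset.image X Finset.univ)) :=
          Finset.sum_le_sum fun X _ => mul_le_mul_of_nonneg_left (hg _)
            (Finset.prod_nonneg fun i _ => hD0 _)
      _ = r * ∑ X : Fin m → B, (∏ i, D (X i)) * g (Finset.image X Finset.univ) := by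
          rw [Finset.mul_sum]
          exact Finset.sum_congr rfl fun X _ => by ring
      _ ≤ r * (r ^ m * g ∅) := mul_le_mul_of_nonneg_left ih hr
      _ = r ^ (m + 1) * g ∅ := by ring

/-- The weight `2 ^ (-|S ∩ T|)`, cut off to `0` once the mass of `S ∩ T` exceeds `ε / 2`. -/
noncomputable def lightWeight {B : Type*} [DecidableEq B] (D : B → ℝ) (T : Finset B) (ε : ℝ)
    (S : Finset B) : ℝ :=
  if ∑ b ∈ S ∩ T, D b ≤ ε / 2 then (1 / 2) ^ (S ∩ T).card else 0

theorem lightWeight_nonneg {B : Type*} [DecidableEq B] (D : B → ℝ) (T : Finset B) (ε : ℝ)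
    (S : Finset B) : 0 ≤ lightWeight D T ε S := by
  unfold lightWeight
  split_ifs <;> positivity

theorem lightWeight_insert_le {B : Type*} [DecidableEq B] (D : B → ℝ) (hD0 : ∀ b, 0 ≤ D b)
    (T : Finset B) (ε : ℝ) (S : Finset B) (b : B) :
    lightWeight D T ε (insert b S) ≤
      (if b ∈ T \ S then 1 / 2 else 1) * lightWeight D T ε S := by
  by_cases hb : b ∈ T \ S
  · obtain ⟨hbT, hbS⟩ := Finset.mem_sdiff.1 hb
    have hbST : b ∉ S ∩ T := fun h => hbS (Finset.mem_inter.1 h).1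
    have hb0 := hD0 b
    rw [if_pos hb]
    unfold lightWeight
    rw [Finset.insert_inter_of_mem hbT, Finset.sum_insert hbST, Finset.card_insert_of_notMem hbST]
    split_ifs with h₁ h₂ h₂
    · exact (pow_succ' _ _).le
    · linarith
    · positivity
    · simp
  · have hST : insert b S ∩ T = S ∩ T := by
      ext x
      simp only [Finset.mem_inter, Finset.mem_insert, Finset.mem_sdiff] at hb ⊢
      grind
    rw [if_neg hb, one_mul]
    unfold lightWeight
    rw [hST]

theorem sum_mul_lightWeight_insert_le {B : Type*} [Fintype B] [DecidableEq B]
    (D : B → ℝ) (hD0 : ∀ b, 0 ≤ D b) (hD1 : ∑ b, D b = 1)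
    (T : Finset B) (ε : ℝ) (hT : ε ≤ ∑ t ∈ T, D t) (S : Finset B) :
    ∑ b, D b * lightWeight D T ε (insert b S) ≤ (1 - ε / 4) * lightWeight D T ε S := by
  have hle : ∑ b, D b * lightWeight D T ε (insert b S) ≤
      (1 - (∑ b ∈ T \ S, D b) / 2) * lightWeight D T ε S :=
    calc ∑ b, D b * lightWeight D T ε (insert b S)
        ≤ ∑ b, D b * ((if b ∈ T \ S then 1 / 2 else 1) * lightWeight D T ε S) :=
          Finset.sum_le_sum fun b _ =>
            mul_le_mul_of_nonneg_left (lightWeight_insert_le D hD0 T ε S b) (hD0 b)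
      _ = (∑ b, (D b - (if b ∈ T \ S then D b else 0) / 2)) * lightWeight D T ε S := by
          rw [Finset.sum_mul]
          refine Finset.sum_congr rfl fun b _ => ?_
          split_ifs <;> ring
      _ = (1 - (∑ b ∈ T \ S, D b) / 2) * lightWeight D T ε S := by
          rw [Finset.sum_sub_distrib, hD1, ← Finset.sum_div, Finset.sum_ite_mem,
            Finset.univ_inter]
  by_cases hS : ∑ b ∈ S ∩ T, D b ≤ ε / 2
  · refine hle.trans (mul_le_mul_of_nonneg_right ?_ (lightWeight_nonneg D T ε S))
    have hsplit := Finset.sum_inter_add_sum_sdiff T S D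
    rw [Finset.inter_comm] at hsplit
    linarith
  · have h_zero : lightWeight D T ε S = 0 := if_neg hS
    simpa [h_zero] using hle

/-- Lemma 7.1: sampling mass accumulates on a heavy set T.  The probability that the
sampled mass of S ∩ T stays below min(εpm/4, ε/2) is at most e^{-εm/16}. -/
theorem birthday_prelim
    {B : Type*} [Fintype B] [DecidableEq B]
    (D : B → ℝ) (hD0 : ∀ b, 0 ≤ D b) (hD1 : ∑ b, D b = 1)
    (T : Finset B) (ε p : ℝ) (hε : 0 < ε) (hp : 0 < p)
    (hT : ε ≤ ∑ t ∈ T, D t) (hTp : ∀ t ∈ T, p ≤ D t)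
    (m : ℕ) :
    ∑ X : Fin m → B,
      (if ∑ b ∈ (Finset.image X Finset.univ) ∩ T, D b ≤ min (ε * p * m / 4) (ε / 2)
       then ∏ i, D (X i) else 0)
      ≤ Real.exp (-(ε * m) / 16) := by
  have hε1 : ε ≤ 1 := hT.trans <| hD1 ▸
    Finset.sum_le_univ_sum_of_nonneg hD0
  have one_le (S : Finset B) (hS : ∑ b ∈ S ∩ T, D b ≤ min (ε * p * m / 4) (ε / 2)) :
      1 ≤ Real.exp (Real.log 2 * (ε * m / 4)) * lightWeight D T ε S := by
    obtain ⟨h₁, h₂⟩ := le_min_iff.1 hS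
    have hcard : ((S ∩ T).card : ℝ) ≤ ε * m / 4 := by
      have h := Finset.card_nsmul_le_sum (S ∩ T) D p
        fun b hb => hTp b (Finset.mem_inter.1 hb).2
      rw [nsmul_eq_mul] at h
      refine le_of_mul_le_mul_right (h.trans (h₁.trans_eq ?_)) hp
      ring
    have hpow : ((1 : ℝ) / 2) ^ (S ∩ T).card = Real.exp (-(Real.log 2 * (S ∩ T).card)) := by
      rw [Real.exp_neg, mul_comm, Real.exp_nat_mul, Real.exp_log two_pos, one_div, inv_pow]
    rw [lightWeight, if_pos h₂, hpow, ← Real.exp_add]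
    refine Real.one_le_exp ?_
    have := mul_le_mul_of_nonneg_left hcard (Real.log_nonneg one_le_two)
    linarith
  calc ∑ X : Fin m → B,
        (if ∑ b ∈ (Finset.image X Finset.univ) ∩ T, D b ≤ min (ε * p * m / 4) (ε / 2)
          then ∏ i, D (X i) else 0)
      ≤ ∑ X : Fin m → B, Real.exp (Real.log 2 * (ε * m / 4)) *
          ((∏ i, D (X i)) * lightWeight D T ε (Finset.image X Finset.univ)) := by
        refine Finset.sum_le_sum fun X _ => ?_
        have hprod : 0 ≤ ∏ i, D (X i) := Finset.prod_nonneg fun i _ => hD0 _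
        split_ifs with h
        · have := mul_le_mul_of_nonneg_left (one_le _ h) hprod
          linarith
        · exact mul_nonneg (Real.exp_nonneg _) (mul_nonneg hprod (lightWeight_nonneg _ _ _ _))
    _ ≤ Real.exp (Real.log 2 * (ε * m / 4)) * ((1 - ε / 4) ^ m * lightWeight D T ε ∅) := by
        rw [← Finset.mul_sum]
        exact mul_le_mul_of_nonneg_left
          (sum_prod_mul_image_le D hD0 _ _ (by linarith)
            (sum_mul_lightWeight_insert_le D hD0 hD1 T ε hT) m) (Real.exp_nonneg _)
    _ ≤ Real.exp (Real.log 2 * (ε * m / 4)) * Real.exp (m * (-(ε / 4))) := by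
        have h_empty : lightWeight D T ε ∅ = 1 := by simp [lightWeight, (half_pos hε).le]
        rw [h_empty, mul_one, Real.exp_nat_mul]
        refine mul_le_mul_of_nonneg_left (pow_le_pow_left₀ (by linarith) ?_ m) (Real.exp_nonneg _)
        exact Real.one_sub_le_exp_neg _
    _ ≤ Real.exp (-(ε * m) / 16) := by
        rw [← Real.exp_add]
        refine Real.exp_le_exp.2 ?_
        have hlog : Real.log 2 ≤ 3 / 4 := by linarith [Real.log_two_lt_d9]
        have := mul_le_mul_of_nonneg_right hlog (by positivity : 0 ≤ ε * m / 4)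
        linarith
end

section
/- Let n be a positive integer and let 𝒟 be a probability distribution over [n+1]. Let p_i = 𝒟({i}) for each i ∈ [n+1], and let ε = p₁ + ⋯ + p_n, assumed positive. Let S and S' be the sets formed by m and m' independent samples from 𝒟 respectively, where m and m' are positive integers satisfying m·m' ≥ 100·n/ε² and m, m' ≥ 200/ε. Then with probability at least 0.99 there exists i ∈ [n] that appears in both S and S'. -/
open scoped Classical

/-- The probability that `m` independent samples from `D` all avoid `T` is at most
`∏ i ∈ T, exp (-m * D i)`. -/
lemma sum_prod_avoid_le {α : Type*} [Fintype α] [DecidableEq α] (D : α → ℝ) (hD0 : ∀ i, 0 ≤ D i)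
    (hD1 : ∑ i, D i = 1) (m : ℕ) (T : Finset α) :
    ∑ X : Fin m → α, (∏ a, D (X a)) * (if ∀ a, X a ∉ T then 1 else 0)
      ≤ ∏ i ∈ T, Real.exp (-(m * D i)) := by
  have hpow : ∑ X : Fin m → α, (∏ a, D (X a)) * (if ∀ a, X a ∉ T then (1 : ℝ) else 0)
      = (∑ j, D j * (if j ∉ T then 1 else 0)) ^ m := by
    rw [Fintype.sum_pow]
    refine Finset.sum_congr rfl fun X _ => ?_
    rw [Finset.prod_mul_distrib, Finset.prod_ite_zero]
    simp
  have hsum : ∑ j, D j * (if j ∉ T then (1 : ℝ) else 0) = 1 - ∑ i ∈ T, D i := by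
    have hsplit : ∀ j, D j * (if j ∉ T then (1 : ℝ) else 0) = D j - (if j ∈ T then D j else 0) := by
      intro j
      split_ifs <;> simp_all
    rw [Finset.sum_congr rfl fun j _ => hsplit j, Finset.sum_sub_distrib, hD1]
    simp
  have hnonneg : 0 ≤ 1 - ∑ i ∈ T, D i := by
    rw [← hsum]
    exact Finset.sum_nonneg fun j _ => mul_nonneg (hD0 j) (by split_ifs <;> simp)
  rw [hpow, hsum, ← Real.exp_sum, Finset.sum_neg_distrib, ← Finset.mul_sum,
    ← mul_neg, Real.exp_nat_mul]
  exact pow_le_pow_left₀ hnonneg (Real.one_sub_le_exp_neg _) m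

/-- If every `φ i` lies in `[0, 1]`, the expectation of the product of `φ i` over the sampled `i`
is bounded as if the events that `i` is sampled were independent. -/
lemma sum_prod_hit_le {n : ℕ} (D : Fin (n + 1) → ℝ) (hD0 : ∀ i, 0 ≤ D i) (hD1 : ∑ i, D i = 1)
    (m : ℕ) (φ : Fin n → ℝ) (hφ0 : ∀ i, 0 ≤ φ i) (hφ1 : ∀ i, φ i ≤ 1) :
    ∑ X : Fin m → Fin (n + 1), (∏ a, D (X a)) *
        ∏ i, (if ∃ a, X a = Fin.castSucc i then φ i else 1)
      ≤ ∏ i, ((1 - φ i) * Real.exp (-(m * D i.castSucc)) + φ i) := by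
  have hexpand : ∀ X : Fin m → Fin (n + 1),
      ∏ i, (if ∃ a, X a = Fin.castSucc i then φ i else 1)
        = ∑ T : Finset (Fin n), ((∏ i ∈ T, (1 - φ i)) * ∏ i ∈ Finset.univ \ T, φ i) *
            (if ∀ a, X a ∉ T.map Fin.castSuccEmb then 1 else 0) := by
    intro X
    have hfactor : ∀ i, (if ∃ a, X a = Fin.castSucc i then φ i else 1)
        = (1 - φ i) * (if ∀ a, X a ≠ Fin.castSucc i then 1 else 0) + φ i := by
      intro i
      by_cases h : ∃ a, X a = Fin.castSucc i
      · have h' : ¬ ∀ a, X a ≠ Fin.castSucc i := by simpa using h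
        rw [if_pos h, if_neg h']
        ring
      · have h' : ∀ a, X a ≠ Fin.castSucc i := by simpa using h
        rw [if_neg h, if_pos h']
        ring
    rw [Finset.prod_congr rfl fun i _ => hfactor i, Finset.prod_add, Finset.powerset_univ]
    refine Finset.sum_congr rfl fun T _ => ?_
    rw [Finset.prod_mul_distrib, Finset.prod_ite_zero]
    have hiff : (∀ i ∈ T, ∀ a, X a ≠ Fin.castSucc i) ↔ ∀ a, X a ∉ T.map Fin.castSuccEmb := by
      simp only [Finset.mem_map, Fin.castSuccEmb_apply, not_exists, not_and]
      exact ⟨fun h a i hi he => h i hi a he.symm, fun h i hi a he => h a i hi he.symm⟩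
    simp only [hiff, Finset.prod_const_one]
    ring
  calc ∑ X : Fin m → Fin (n + 1), (∏ a, D (X a)) *
        ∏ i, (if ∃ a, X a = Fin.castSucc i then φ i else 1)
      = ∑ T : Finset (Fin n), ((∏ i ∈ T, (1 - φ i)) * ∏ i ∈ Finset.univ \ T, φ i) *
          ∑ X : Fin m → Fin (n + 1), (∏ a, D (X a)) *
            (if ∀ a, X a ∉ T.map Fin.castSuccEmb then 1 else 0) := by
        simp only [hexpand, Finset.mul_sum]
        rw [Finset.sum_comm]
        exact Finset.sum_congr rfl fun T _ => Finset.sum_congr rfl fun X _ => by ring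
    _ ≤ ∑ T : Finset (Fin n), ((∏ i ∈ T, (1 - φ i)) * ∏ i ∈ Finset.univ \ T, φ i) *
          ∏ i ∈ T, Real.exp (-(m * D i.castSucc)) := by
        refine Finset.sum_le_sum fun T _ => mul_le_mul_of_nonneg_left ?_
          (mul_nonneg (Finset.prod_nonneg fun i _ => sub_nonneg.2 (hφ1 i))
            (Finset.prod_nonneg fun i _ => hφ0 i))
        simpa only [Finset.prod_map, Fin.castSuccEmb_apply] using
          sum_prod_avoid_le D hD0 hD1 m (T.map Fin.castSuccEmb)
    _ = ∏ i, ((1 - φ i) * Real.exp (-(m * D i.castSucc)) + φ i) := by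
        rw [Finset.prod_add, Finset.powerset_univ]
        refine Finset.sum_congr rfl fun T _ => ?_
        rw [Finset.prod_mul_distrib]
        ring

/-- A product bound on the probability that two independent sample sets share no element other
than `Fin.last n`. -/
lemma sum_no_collision_le {n : ℕ} (D : Fin (n + 1) → ℝ) (hD0 : ∀ i, 0 ≤ D i)
    (hD1 : ∑ i, D i = 1) (m m' : ℕ) :
    ∑ X : Fin m → Fin (n + 1), ∑ Y : Fin m' → Fin (n + 1),
      (if ∃ i : Fin n, (∃ a, X a = i.castSucc) ∧ (∃ b, Y b = i.castSucc)
       then 0 else (∏ a, D (X a)) * (∏ b, D (Y b)))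
      ≤ ∏ i : Fin n, (1 - (1 - Real.exp (-(m * D i.castSucc))) *
          (1 - Real.exp (-(m' * D i.castSucc)))) := by
  calc _ ≤ ∑ X : Fin m → Fin (n + 1), (∏ a, D (X a)) *
        ∏ i : Fin n, (if ∃ a, X a = Fin.castSucc i then Real.exp (-(m' * D i.castSucc)) else 1) := by
        refine Finset.sum_le_sum fun X _ => ?_
        set T : Finset (Fin n) := Finset.univ.filter fun i => ∃ a, X a = Fin.castSucc i with hT
        have hiff : ∀ Y : Fin m' → Fin (n + 1),
            (∃ i : Fin n, (∃ a, X a = i.castSucc) ∧ (∃ b, Y b = i.castSucc)) ↔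
              ¬ ∀ b, Y b ∉ T.map Fin.castSuccEmb := by
          intro Y
          simp only [hT, Finset.mem_map, Finset.mem_filter, Finset.mem_univ, true_and,
            Fin.castSuccEmb_apply, not_forall, not_not]
          exact ⟨fun ⟨i, h, b, hb⟩ => ⟨b, i, h, hb.symm⟩, fun ⟨b, i, h, hb⟩ => ⟨i, h, b, hb.symm⟩⟩
        have hterm : ∀ Y : Fin m' → Fin (n + 1),
            (if ∃ i : Fin n, (∃ a, X a = i.castSucc) ∧ (∃ b, Y b = i.castSucc)
              then 0 else (∏ a, D (X a)) * (∏ b, D (Y b))) =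
            (∏ a, D (X a)) *
              ((∏ b, D (Y b)) * (if ∀ b, Y b ∉ T.map Fin.castSuccEmb then 1 else 0)) := by
          intro Y
          by_cases h : ∀ b, Y b ∉ T.map Fin.castSuccEmb
          · rw [if_neg (by rw [hiff]; exact not_not.2 h), if_pos h, mul_one]
          · rw [if_pos ((hiff Y).2 h), if_neg h, mul_zero, mul_zero]
        rw [Finset.sum_congr rfl fun Y _ => hterm Y, ← Finset.mul_sum]
        refine mul_le_mul_of_nonneg_left ?_ (Finset.prod_nonneg fun a _ => hD0 _)
        rw [← Finset.prod_filter]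
        simpa only [Finset.prod_map, Fin.castSuccEmb_apply] using
          sum_prod_avoid_le D hD0 hD1 m' (T.map Fin.castSuccEmb)
    _ ≤ _ := sum_prod_hit_le D hD0 hD1 m _ (fun i => (Real.exp_pos _).le)
        (fun i => Real.exp_le_one_iff.2 (neg_nonpos.2 (mul_nonneg m'.cast_nonneg (hD0 _))))
    _ = _ := Finset.prod_congr rfl fun i _ => by ring

lemma half_le_one_sub_exp_neg {x : ℝ} (hx0 : 0 ≤ x) (hx1 : x ≤ 1) :
    x / 2 ≤ 1 - Real.exp (-x) := by
  have h : (1 + x) * Real.exp (-x) ≤ 1 := by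
    have h1 := Real.add_one_le_exp x
    have h2 : Real.exp x * Real.exp (-x) = 1 := by rw [← Real.exp_add]; simp
    nlinarith [Real.exp_pos (-x)]
  nlinarith [Real.exp_pos (-x)]

lemma one_sub_mul_one_sub_exp_le {x y : ℝ} (hx : 0 ≤ x) (hxy : x ≤ y) :
    1 - (1 - Real.exp (-x)) * (1 - Real.exp (-y)) ≤ Real.exp (-(x * min y 1 / 4)) := by
  rcases le_total x 1 with hx1 | hx1
  · have h1 := half_le_one_sub_exp_neg hx hx1
    have h2 : min y 1 / 2 ≤ 1 - Real.exp (-y) := by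
      refine (half_le_one_sub_exp_neg (le_min (hx.trans hxy) zero_le_one)
        (min_le_right y 1)).trans ?_
      gcongr
      exact min_le_left y 1
    have h3 : x / 2 * (min y 1 / 2) ≤ (1 - Real.exp (-x)) * (1 - Real.exp (-y)) :=
      mul_le_mul h1 h2 (div_nonneg (le_min (hx.trans hxy) zero_le_one) zero_le_two)
        (by linarith)
    have h4 := Real.one_sub_le_exp_neg (x * min y 1 / 4)
    linarith
  · rw [min_eq_right (hx1.trans hxy), mul_one]
    have h1 : Real.exp (-y) ≤ Real.exp (-x) := Real.exp_le_exp.2 (neg_le_neg hxy)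
    have h2 : 2 * Real.exp (-x) ≤ Real.exp (-(x / 4)) := by
      rw [← Real.exp_log (zero_lt_two (α := ℝ)), ← Real.exp_add, Real.exp_le_exp]
      linarith [Real.log_two_lt_d9]
    nlinarith [mul_pos (Real.exp_pos (-x)) (Real.exp_pos (-y))]

/-- The exponents of the collision bound add up to at least `100`. -/
lemma hundred_le_sum_mul_min {n : ℕ} (hn : 0 < n) (p : Fin n → ℝ) (hp : ∀ i, 0 ≤ p i)
    {ε M M' : ℝ} (hε : ε = ∑ i, p i) (hεpos : 0 < ε) (hM : 0 < M) (hM' : 0 < M')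
    (hMM' : 100 * (n : ℝ) / ε ^ 2 ≤ M * M') (hM2 : 200 / ε ≤ M) :
    100 ≤ ∑ i, M * p i * min (M' * p i) 1 := by
  have hn' : (0 : ℝ) < n := Nat.cast_pos.2 hn
  set t := min (ε / n) (1 / (2 * M')) with ht
  have ht0 : 0 < t := lt_min (by positivity) (by positivity)
  have ht1 : n * t ≤ ε := by
    calc n * t ≤ n * (ε / n) := by gcongr; exact min_le_left _ _
      _ = ε := by field_simp
  have ht2 : 2 * M' * t ≤ 1 := by
    calc 2 * M' * t ≤ 2 * M' * (1 / (2 * M')) := by gcongr; exact min_le_right _ _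
      _ = 1 := by field_simp
  have hterm : ∀ i, 2 * t * (M * M') * p i - M * M' * t ^ 2 ≤ M * p i * min (M' * p i) 1 := by
    intro i
    rcases le_total (M' * p i) 1 with h | h
    · rw [min_eq_left h]
      nlinarith [mul_nonneg (mul_pos hM hM').le (sq_nonneg (p i - t))]
    · rw [min_eq_right h]
      nlinarith [mul_le_mul_of_nonneg_left ht2 (mul_nonneg hM.le (hp i)),
        mul_nonneg (mul_pos hM hM').le (sq_nonneg t)]
  have hsum := Finset.sum_le_sum fun i (_ : i ∈ Finset.univ) => hterm i
  rw [Finset.sum_sub_distrib, ← Finset.mul_sum, ← hε] at hsum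
  simp only [Finset.sum_const, Finset.card_univ, Fintype.card_fin, nsmul_eq_mul] at hsum
  have hmain : 100 ≤ M * M' * t * ε := by
    rcases min_choice (ε / n) (1 / (2 * M')) with h | h
    · rw [ht, h]
      rw [div_le_iff₀ (by positivity)] at hMM'
      rw [show M * M' * (ε / n) * ε = M * M' * ε ^ 2 / n by ring, le_div_iff₀ hn']
      exact hMM'
    · rw [ht, h]
      rw [div_le_iff₀ hεpos] at hM2
      rw [show M * M' * (1 / (2 * M')) * ε = M * ε / 2 by field_simp]
      linarith
  nlinarith [mul_le_mul_of_nonneg_left ht1 (mul_nonneg (mul_pos hM hM').le ht0.le)]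

lemma prod_one_sub_mul_le {n : ℕ} (hn : 0 < n) (p : Fin n → ℝ) (hp : ∀ i, 0 ≤ p i)
    {ε M M' : ℝ} (hε : ε = ∑ i, p i) (hεpos : 0 < ε) (hM : 0 < M) (hle : M ≤ M')
    (hMM' : 100 * (n : ℝ) / ε ^ 2 ≤ M * M') (hM2 : 200 / ε ≤ M) :
    ∏ i, (1 - (1 - Real.exp (-(M * p i))) * (1 - Real.exp (-(M' * p i)))) ≤ 0.01 := by
  have hM' : 0 < M' := hM.trans_le hle
  calc ∏ i, (1 - (1 - Real.exp (-(M * p i))) * (1 - Real.exp (-(M' * p i))))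
      ≤ ∏ i, Real.exp (-(M * p i * min (M' * p i) 1 / 4)) := by
        refine Finset.prod_le_prod (fun i _ => ?_) fun i _ =>
          one_sub_mul_one_sub_exp_le (mul_nonneg hM.le (hp i))
            (mul_le_mul_of_nonneg_right hle (hp i))
        have h1 : Real.exp (-(M * p i)) ≤ 1 :=
          Real.exp_le_one_iff.2 (neg_nonpos.2 (mul_nonneg hM.le (hp i)))
        have h2 : Real.exp (-(M' * p i)) ≤ 1 :=
          Real.exp_le_one_iff.2 (neg_nonpos.2 (mul_nonneg hM'.le (hp i)))
        nlinarith [Real.exp_pos (-(M * p i)), Real.exp_pos (-(M' * p i))]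
    _ = Real.exp (-((∑ i, M * p i * min (M' * p i) 1) / 4)) := by
        rw [← Real.exp_sum, Finset.sum_neg_distrib, Finset.sum_div]
    _ ≤ Real.exp (-(25 : ℕ)) := by
        have := hundred_le_sum_mul_min hn p hp hε hεpos hM hM' hMM' hM2
        rw [Real.exp_le_exp]
        push_cast
        linarith
    _ ≤ 0.01 := by
        rw [Real.exp_neg, ← mul_one ((25 : ℕ) : ℝ), Real.exp_nat_mul]
        have h : (2 : ℝ) ^ 25 ≤ Real.exp 1 ^ 25 :=
          pow_le_pow_left₀ zero_le_two (by linarith [Real.add_one_le_exp (1 : ℝ)]) 25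
        exact (inv_anti₀ (by positivity) h).trans (by norm_num)

/-- Classical birthday paradox (Lemma 7.2): two independent sample sets of sizes m, m'
with m·m' ≥ 100n/ε² and m, m' ≥ 200/ε share a common element of [n] with probability
at least 0.99. -/
theorem classical_birthday_bipartite
    (n : ℕ) (hn : 0 < n)
    (D : Fin (n + 1) → ℝ) (hD0 : ∀ i, 0 ≤ D i) (hD1 : ∑ i, D i = 1)
    (ε : ℝ) (hε : ε = ∑ i : Fin n, D i.castSucc) (hεpos : 0 < ε)
    (m m' : ℕ) (hm : 0 < m) (hm' : 0 < m')
    (hmm' : 100 * (n : ℝ) / ε ^ 2 ≤ (m : ℝ) * (m' : ℝ))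
    (hm2 : 200 / ε ≤ (m : ℝ)) (hm'2 : 200 / ε ≤ (m' : ℝ)) :
    0.99 ≤ ∑ X : Fin m → Fin (n + 1), ∑ Y : Fin m' → Fin (n + 1),
      (if ∃ i : Fin n, (∃ a, X a = i.castSucc) ∧ (∃ b, Y b = i.castSucc)
       then (∏ a, D (X a)) * (∏ b, D (Y b)) else 0) := by
  have htotal : ∑ X : Fin m → Fin (n + 1), ∑ Y : Fin m' → Fin (n + 1),
      (∏ a, D (X a)) * (∏ b, D (Y b)) = 1 := by
    rw [← Finset.sum_mul_sum, ← Fintype.sum_pow, ← Fintype.sum_pow, hD1, one_pow, one_pow,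
      one_mul]
  have hsplit : ∀ (X : Fin m → Fin (n + 1)) (Y : Fin m' → Fin (n + 1)),
      (∏ a, D (X a)) * (∏ b, D (Y b)) =
      (if ∃ i : Fin n, (∃ a, X a = i.castSucc) ∧ (∃ b, Y b = i.castSucc)
        then (∏ a, D (X a)) * (∏ b, D (Y b)) else 0) +
      (if ∃ i : Fin n, (∃ a, X a = i.castSucc) ∧ (∃ b, Y b = i.castSucc)
        then 0 else (∏ a, D (X a)) * (∏ b, D (Y b))) := by
    intro X Y
    split_ifs <;> simp
  rw [Finset.sum_congr rfl fun X _ => Finset.sum_congr rfl fun Y _ => hsplit X Y] at htotal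
  simp only [Finset.sum_add_distrib] at htotal
  have hmiss := sum_no_collision_le D hD0 hD1 m m'
  have hprod : ∏ i : Fin n, (1 - (1 - Real.exp (-(m * D i.castSucc))) *
      (1 - Real.exp (-(m' * D i.castSucc)))) ≤ 0.01 := by
    rcases le_total (m : ℝ) m' with h | h
    · exact prod_one_sub_mul_le hn _ (fun i => hD0 _) hε hεpos (Nat.cast_pos.2 hm) h hmm' hm2
    · simp only [mul_comm (1 - Real.exp (-((m : ℝ) * _)))]
      exact prod_one_sub_mul_le hn _ (fun i => hD0 _) hε hεpos (Nat.cast_pos.2 hm') h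
        (by rwa [mul_comm (m' : ℝ)]) hm'2
  norm_num at hprod ⊢
  linarith
end

section
/- Let k be a positive integer. The function f : (0, +∞) → ℝ defined by f(x) = ln(1 − (1 − e^{−x})^k) is concave on (0, +∞). -/
/-- On nonnegative reals, `u ↦ u ^ n / ∑ i ≤ n, u ^ i` is monotone, in cross-multiplied form. -/
theorem pow_mul_geom_sum_le_pow_mul_geom_sum (n : ℕ) {u v : ℝ} (hu : 0 ≤ u) (huv : u ≤ v) :
    u ^ n * ∑ i ∈ Finset.range (n + 1), v ^ i ≤ v ^ n * ∑ i ∈ Finset.range (n + 1), u ^ i := by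
  rw [Finset.mul_sum, Finset.mul_sum]
  refine Finset.sum_le_sum fun i hi => ?_
  obtain ⟨j, rfl⟩ := Nat.exists_eq_add_of_le (Nat.lt_succ_iff.mp (Finset.mem_range.mp hi))
  have hv : 0 ≤ v := hu.trans huv
  calc u ^ (i + j) * v ^ i = u ^ i * v ^ i * u ^ j := by ring
    _ ≤ u ^ i * v ^ i * v ^ j := by gcongr
    _ = v ^ (i + j) * u ^ i := by ring

/-- The derivative of `x ↦ log (1 - (1 - exp (-x)) ^ (n + 1))`, simplified by factoring
`1 - u ^ (n + 1)` through the geometric sum. -/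
theorem hasDerivAt_log_one_sub_pow (n : ℕ) {x : ℝ} (hx : 0 < x) :
    HasDerivAt (fun x : ℝ => Real.log (1 - (1 - Real.exp (-x)) ^ (n + 1)))
      (-((n + 1) * ((1 - Real.exp (-x)) ^ n /
        ∑ i ∈ Finset.range (n + 1), (1 - Real.exp (-x)) ^ i))) x := by
  have hexp : 0 < Real.exp (-x) := Real.exp_pos _
  have hu : 0 ≤ 1 - Real.exp (-x) := by
    rw [sub_nonneg, Real.exp_le_one_iff]
    linarith
  have hS : 0 < ∑ i ∈ Finset.range (n + 1), (1 - Real.exp (-x)) ^ i :=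
    geom_sum_pos hu n.succ_ne_zero
  have hgeom := geom_sum_mul_neg (1 - Real.exp (-x)) (n + 1)
  rw [sub_sub_cancel] at hgeom
  have hne : 1 - (1 - Real.exp (-x)) ^ (n + 1) ≠ 0 := by
    rw [← hgeom]
    positivity
  refine ((((hasDerivAt_neg x).exp.const_sub 1).fun_pow (n + 1)).const_sub 1).log hne
    |>.congr_deriv ?_
  rw [← hgeom]
  push_cast
  field_simp

/-- Proposition 7.4: for every positive integer k, the function
x ↦ ln(1 − (1 − e^{−x})^k) is concave on (0, ∞). -/
theorem log_one_sub_pow_concave (k : ℕ) (hk : 0 < k) :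
    ConcaveOn ℝ (Set.Ioi (0 : ℝ))
      (fun x : ℝ => Real.log (1 - (1 - Real.exp (-x)) ^ k)) := by
  obtain ⟨n, rfl⟩ := Nat.exists_eq_add_one_of_ne_zero hk.ne'
  have hderiv := fun (x : ℝ) (hx : x ∈ Set.Ioi (0 : ℝ)) => hasDerivAt_log_one_sub_pow n hx
  refine AntitoneOn.concaveOn_of_deriv (convex_Ioi 0)
    (fun x hx => (hderiv x hx).continuousAt.continuousWithinAt) ?_ ?_
  all_goals rw [interior_Ioi]
  · exact fun x hx => (hderiv x hx).differentiableAt.differentiableWithinAt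
  · intro x hx y hy hxy
    rw [(hderiv x hx).deriv, (hderiv y hy).deriv]
    have hu : 0 ≤ 1 - Real.exp (-x) := by
      rw [sub_nonneg, Real.exp_le_one_iff]
      exact neg_nonpos.mpr (le_of_lt hx)
    have huv : 1 - Real.exp (-x) ≤ 1 - Real.exp (-y) := by gcongr
    refine neg_le_neg (mul_le_mul_of_nonneg_left ?_ (by positivity))
    rw [div_le_div_iff₀ (geom_sum_pos hu n.succ_ne_zero)
      (geom_sum_pos (hu.trans huv) n.succ_ne_zero)]
    exact pow_mul_geom_sum_le_pow_mul_geom_sum n hu huv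
end

section
/- Let k be a positive integer and let a₁, …, a_k be positive real numbers with a₁ + ⋯ + a_k = 1. Then the function g : (0, +∞) → (0, 1) defined by g(x) = (1 − ∏_{j=1}^{k} (1 − e^{−x^{−a_j}}))^x is non-increasing on (0, +∞). -/
/-- For `0 ≤ c ≤ 1`, the quotient `(1 - e^{-cs}) / (1 - e^{-s})` is non-decreasing in `s > 0`. -/
theorem one_sub_exp_neg_mul_div_le {c s t : ℝ} (hc0 : 0 ≤ c) (hc1 : c ≤ 1) (hs : 0 < s)
    (hst : s ≤ t) :
    (1 - Real.exp (-(c * s))) / (1 - Real.exp (-s)) ≤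
      (1 - Real.exp (-(c * t))) / (1 - Real.exp (-t)) := by
  have hs1 : Real.exp (-s) < 1 := Real.exp_lt_one_iff.2 (by linarith)
  have ht1 : Real.exp (-t) < 1 := Real.exp_lt_one_iff.2 (by linarith)
  have hts : Real.exp (-t) ≤ Real.exp (-s) := Real.exp_le_exp.2 (by linarith)
  have hpow (r : ℝ) : Real.exp (-r) ^ c = Real.exp (-(c * r)) := by
    rw [← Real.exp_mul]; ring_nf
  have hv : 0 < 1 - Real.exp (-t) := by linarith
  obtain ⟨-, hconc⟩ := Real.concaveOn_rpow hc0 hc1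
  replace hconc := hconc
    (Set.mem_Ici.2 (Real.exp_pos (-t)).le) (Set.mem_Ici.2 (zero_le_one' ℝ))
    (show 0 ≤ (1 - Real.exp (-s)) / (1 - Real.exp (-t)) from div_nonneg (by linarith) hv.le)
    (show 0 ≤ (Real.exp (-s) - Real.exp (-t)) / (1 - Real.exp (-t)) from
      div_nonneg (by linarith) hv.le)
    (by field_simp; ring)
  have hcomb : (1 - Real.exp (-s)) / (1 - Real.exp (-t)) * Real.exp (-t) +
      (Real.exp (-s) - Real.exp (-t)) / (1 - Real.exp (-t)) * 1 = Real.exp (-s) := by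
    field_simp; ring
  simp only [smul_eq_mul, Real.one_rpow] at hconc
  rw [hcomb, hpow, hpow, div_mul_eq_mul_div, div_mul_eq_mul_div, ← add_div,
    div_le_iff₀ hv] at hconc
  rw [div_le_div_iff₀ (by linarith) hv]
  linarith

theorem one_sub_exp_neg_prod_mul_div_le {ι : Type*} (S : Finset ι) (c t : ι → ℝ) {T : ℝ}
    (hT : 0 < T) (hc0 : ∀ i, 0 < c i) (hc1 : ∀ i, c i ≤ 1) (hTt : ∀ i, T ≤ t i) :
    (1 - Real.exp (-((∏ i ∈ S, c i) * T))) / (1 - Real.exp (-T)) ≤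
      ∏ i ∈ S, (1 - Real.exp (-(c i * t i))) / (1 - Real.exp (-t i)) := by
  have hpos {r : ℝ} (hr : 0 < r) : 0 < 1 - Real.exp (-r) :=
    sub_pos.2 (Real.exp_lt_one_iff.2 (by linarith))
  induction S using Finset.cons_induction with
  | empty => simp [(hpos hT).ne']
  | cons i S hi ih =>
    rw [Finset.prod_cons, Finset.prod_cons]
    set C := ∏ i ∈ S, c i
    have hC0 : 0 < C := Finset.prod_pos fun i _ => hc0 i
    have hC1 : C ≤ 1 := Finset.prod_le_one (fun i _ => (hc0 i).le) fun i _ => hc1 i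
    have hCT : 0 < C * T := mul_pos hC0 hT
    have hCTt : C * T ≤ t i := (mul_le_of_le_one_left hT.le hC1).trans (hTt i)
    rw [mul_assoc, ← div_mul_div_cancel₀ (hpos hCT).ne']
    exact mul_le_mul (one_sub_exp_neg_mul_div_le (hc0 i).le (hc1 i) hCT hCTt) ih
      (div_nonneg (hpos hCT).le (hpos hT).le)
      (div_nonneg (hpos (mul_pos (hc0 i) (hT.trans_le (hTt i)))).le
        (hpos (hT.trans_le (hTt i))).le)

/-- Proposition 7.5: for positive a₁, …, a_k summing to 1, the function
g(x) = (1 − ∏_j (1 − e^{−x^{−a_j}}))^x is non-increasing on (0, ∞). -/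
theorem g_antitone (k : ℕ) (hk : 0 < k) (a : Fin k → ℝ)
    (ha : ∀ j, 0 < a j) (hsum : ∑ j, a j = 1) :
    AntitoneOn
      (fun x : ℝ => (1 - ∏ j, (1 - Real.exp (-(x ^ (-(a j)))))) ^ x)
      (Set.Ioi (0 : ℝ)) := by
  intro x hx y hy hxy
  rw [Set.mem_Ioi] at hx hy
  have hpos {r : ℝ} (hr : 0 < r) : 0 < 1 - Real.exp (-r) :=
    sub_pos.2 (Real.exp_lt_one_iff.2 (by linarith))
  have hfac {z : ℝ} (hz : 0 < z) (j : Fin k) : 0 < 1 - Real.exp (-(z ^ (-(a j)))) :=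
    hpos (Real.rpow_pos_of_pos hz _)
  have hprod_le {z : ℝ} (hz : 0 < z) (j : Fin k) :
      ∏ i, (1 - Real.exp (-(z ^ (-(a i))))) ≤ 1 - Real.exp (-(z ^ (-(a j)))) := by
    rw [← Finset.mul_prod_erase _ _ (Finset.mem_univ j)]
    exact mul_le_of_le_one_right (hfac hz j).le
      (Finset.prod_le_one (fun i _ => (hfac hz i).le)
        fun i _ => sub_le_self _ (Real.exp_pos _).le)
  have hbase {z : ℝ} (hz : 0 < z) : 0 < 1 - ∏ i, (1 - Real.exp (-(z ^ (-(a i))))) := by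
    linarith [hprod_le hz ⟨0, hk⟩, Real.exp_pos (-(z ^ (-(a ⟨0, hk⟩))))]
  have hP : 0 < ∏ i, (1 - Real.exp (-(x ^ (-(a i))))) := Finset.prod_pos fun i _ => hfac hx i
  obtain ⟨T, hT⟩ : ∃ T, Real.exp (-T) = 1 - ∏ i, (1 - Real.exp (-(x ^ (-(a i))))) :=
    ⟨-Real.log _, by rw [neg_neg, Real.exp_log (hbase hx)]⟩
  have hT0 : 0 < T := by
    have : Real.exp (-T) < 1 := by linarith
    linarith [Real.exp_lt_one_iff.1 this]
  have hTt (j : Fin k) : T ≤ x ^ (-(a j)) := by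
    have : Real.exp (-(x ^ (-(a j)))) ≤ Real.exp (-T) := by linarith [hprod_le hx j]
    linarith [Real.exp_le_exp.1 this]
  have hxy0 : 0 < x / y := div_pos hx hy
  have hmul (j : Fin k) : (x / y) ^ a j * x ^ (-(a j)) = y ^ (-(a j)) := by
    rw [Real.div_rpow hx.le hy.le, Real.rpow_neg hx.le, Real.rpow_neg hy.le]
    have := (Real.rpow_pos_of_pos hx (a j)).ne'
    field_simp
  have key := one_sub_exp_neg_prod_mul_div_le Finset.univ (fun j => (x / y) ^ a j)
    (fun j => x ^ (-(a j))) hT0 (fun j => Real.rpow_pos_of_pos hxy0 _)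
    (fun j => Real.rpow_le_one hxy0.le ((div_le_one hy).2 hxy) (ha j).le) hTt
  rw [← Real.rpow_sum_of_pos hxy0, hsum, Real.rpow_one] at key
  simp only [hmul, Finset.prod_div_distrib] at key
  rw [hT, sub_sub_cancel, div_le_div_iff_of_pos_right hP] at key
  calc (1 - ∏ j, (1 - Real.exp (-(y ^ (-(a j)))))) ^ y
      ≤ Real.exp (-(x / y * T)) ^ y :=
        Real.rpow_le_rpow (hbase hy).le (by linarith) hy.le
    _ = Real.exp (-T) ^ x := by
        rw [← Real.exp_mul, ← Real.exp_mul]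
        congr 1
        field_simp
    _ = _ := by rw [hT]
end

section
/- For every positive integer m, if Z is a Poisson random variable with mean m, then Pr[Z ≤ m] ≥ 1/4. -/
/-- The Poisson cumulative distribution function at `n`, as a function of the mean `x`, has
derivative `-e^{-x} x ^ n / n!`. -/
lemma hasDerivAt_poisson_cdf (n : ℕ) (x : ℝ) :
    HasDerivAt (fun y : ℝ ↦ ∑ t ∈ Finset.range (n + 1), Real.exp (-y) * y ^ t / (t.factorial : ℝ))
      (-(Real.exp (-x) * x ^ n / (n.factorial : ℝ))) x := by
  have hexp : HasDerivAt (fun y : ℝ ↦ Real.exp (-y)) (-Real.exp (-x)) x := by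
    simpa using (hasDerivAt_neg x).exp
  induction n with
  | zero => simpa using hexp
  | succ n ih =>
    simp_rw [Finset.sum_range_succ _ (n + 1)]
    refine (ih.add ((hexp.mul (hasDerivAt_pow (n + 1) x)).div_const
      ((n + 1).factorial : ℝ))).congr_deriv ?_
    rw [Nat.factorial_succ]
    push_cast
    field_simp
    ring

lemma one_sub_mul_exp_le {u : ℝ} (hu : 0 ≤ u) :
    (1 - u) * Real.exp u ≤ (1 + u) * Real.exp (-u) := by
  have hderiv (x : ℝ) : HasDerivAt
      (fun x : ℝ ↦ (1 + x) * Real.exp (-x) - (1 - x) * Real.exp x)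
      (x * (Real.exp x - Real.exp (-x))) x := by
    refine ((((hasDerivAt_id x).const_add 1).mul (hasDerivAt_neg x).exp).sub
      (((hasDerivAt_id x).const_sub 1).mul (Real.hasDerivAt_exp x))).congr_deriv ?_
    simp only [id]
    ring
  have hmono := monotoneOn_of_hasDerivWithinAt_nonneg (convex_Ici (0 : ℝ))
    (fun x _ ↦ (hderiv x).continuousAt.continuousWithinAt)
    (fun x _ ↦ (hderiv x).hasDerivWithinAt) (fun x hx ↦ by
      rw [interior_Ici, Set.mem_Ioi] at hx
      exact mul_nonneg hx.le (sub_nonneg.2 (Real.exp_le_exp.2 (by linarith))))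
  simpa using hmono Set.self_mem_Ici hu hu

lemma exp_mul_pow_reflect_le {m : ℕ} (hm : 0 < m) {y : ℝ} (hy : 0 ≤ y) (hym : y ≤ m) :
    Real.exp (-(m - y)) * (m - y) ^ m ≤ Real.exp (-(m + y)) * (m + y) ^ m := by
  have hm' : (0 : ℝ) < m := by exact_mod_cast hm
  have hpow (z : ℝ) : Real.exp (-(m + z)) * (m + z) ^ m =
      Real.exp (-m) * (m * ((1 + z / m) * Real.exp (-(z / m)))) ^ m := by
    rw [mul_pow, mul_pow, ← Real.exp_nat_mul, neg_add, Real.exp_add,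
      show (m : ℝ) * -(z / m) = -z by field_simp, ← mul_assoc ((m : ℝ) ^ m), ← mul_pow,
      show (m : ℝ) * (1 + z / m) = m + z by field_simp]
    ring
  have hneg := hpow (-y)
  rw [neg_div, neg_neg, ← sub_eq_add_neg, ← sub_eq_add_neg] at hneg
  rw [hneg, hpow]
  have hle : y / m ≤ 1 := (div_le_one hm').2 hym
  have hnonneg : 0 ≤ (1 - y / m) * Real.exp (y / m) :=
    mul_nonneg (sub_nonneg.2 hle) (Real.exp_nonneg _)
  have hbase := one_sub_mul_exp_le (div_nonneg hy hm'.le)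
  exact mul_le_mul_of_nonneg_left (pow_le_pow_left₀ (mul_nonneg hm'.le hnonneg)
    (mul_le_mul_of_nonneg_left hbase hm'.le) m) (Real.exp_nonneg _)

/-- The integer mean of a Poisson distribution is at least its median. -/
lemma half_le_poisson_cdf {m : ℕ} (hm : 0 < m) :
    (1 : ℝ) / 2 ≤ ∑ t ∈ Finset.range (m + 1),
      Real.exp (-(m : ℝ)) * (m : ℝ) ^ t / (Nat.factorial t : ℝ) := by
  set G : ℝ → ℝ := fun y ↦
    ∑ t ∈ Finset.range (m + 1), Real.exp (-y) * y ^ t / (t.factorial : ℝ) with hG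
  have hderiv (y : ℝ) : HasDerivAt (fun y ↦ G (m + y) + G (m - y))
      (-(Real.exp (-(m + y)) * (m + y) ^ m / (m.factorial : ℝ)) +
        Real.exp (-(m - y)) * (m - y) ^ m / (m.factorial : ℝ)) y := by
    refine (((hasDerivAt_poisson_cdf m (m + y)).comp_const_add (m : ℝ) y).add
      ((hasDerivAt_poisson_cdf m (m - y)).comp_const_sub (m : ℝ) y)).congr_deriv ?_
    ring
  have hanti := antitoneOn_of_hasDerivWithinAt_nonpos (convex_Icc (0 : ℝ) m)
    (fun y _ ↦ (hderiv y).continuousAt.continuousWithinAt)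
    (fun y _ ↦ (hderiv y).hasDerivWithinAt) (fun y hy ↦ by
      rw [interior_Icc] at hy
      have := div_le_div_of_nonneg_right (exp_mul_pow_reflect_le hm hy.1.le hy.2.le)
        (Nat.cast_nonneg (α := ℝ) m.factorial)
      linarith)
  have hm0 : (0 : ℝ) ≤ m := Nat.cast_nonneg m
  have hle := hanti (Set.left_mem_Icc.2 hm0) (Set.right_mem_Icc.2 hm0) hm0
  have hzero : G 0 = 1 := by simp [hG, Finset.sum_range_succ']
  have hnonneg : 0 ≤ G (m + m) := Finset.sum_nonneg fun _ _ ↦ by positivity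
  simp only [add_zero, sub_zero, sub_self, hzero] at hle
  change 1 / 2 ≤ G m
  linarith

/-- A Poisson random variable with positive integer mean m satisfies
Pr[Z ≤ m] = ∑_{t=0}^{m} e^{−m} m^t / t! ≥ 1/4. -/
theorem poisson_median (m : ℕ) (hm : 0 < m) :
    (1 : ℝ) / 4 ≤ ∑ t ∈ Finset.range (m + 1),
      Real.exp (-(m : ℝ)) * (m : ℝ) ^ t / (Nat.factorial t : ℝ) :=
  le_trans (by norm_num) (half_le_poisson_cdf hm)
end

section
/- Let n and k be positive integers. Let p₁, …, p_{n+1} be nonnegative reals with p₁ + ⋯ + p_{n+1} = 1/k, and let 𝒟 be the probability distribution over [n+1] × [k] with 𝒟({(i, j)}) = p_i for every i ∈ [n+1] and j ∈ [k]. Let ε = p₁ + ⋯ + p_n, assumed positive, and let m be a positive integer with m ≥ 10·k·n^{(k−1)/k}/ε. Draw m independent samples from 𝒟, and for each (i, j) let Y_{ij} be the number of times (i, j) is drawn. Then Pr[for every i ∈ [n] there exists j ∈ [k] with Y_{ij} = 0] ≤ 1/100. -/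
open scoped Classical

namespace BirthdayHypergraph

open Finset

/-- Coefficients of the multilinear polynomial `1 - ∏ j, (1 - z j)`. -/
noncomputable def unionCoeff {κ : Type*} (T : Finset κ) : ℝ :=
  (if T = ∅ then 1 else 0) - (-1) ^ T.card

lemma one_sub_prod_one_sub {κ : Type*} [Fintype κ] (z : κ → ℝ) :
    1 - ∏ j, (1 - z j) = ∑ T : Finset κ, unionCoeff T * ∏ j ∈ T, z j := by
  have h : ∏ j, (1 - z j) = ∑ T : Finset κ, (-1) ^ T.card * ∏ j ∈ T, z j := by
    simp only [sub_eq_neg_add]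
    rw [Finset.prod_add]
    simp [Finset.prod_neg]
  simp [h, unionCoeff, sub_mul, Finset.sum_sub_distrib, ite_mul]

lemma prod_one_sub_prod_one_sub {ι κ : Type*} [Fintype ι] [Fintype κ] (z : ι → κ → ℝ) :
    ∏ i, (1 - ∏ j, (1 - z i j)) =
      ∑ T : ι → Finset κ, (∏ i, unionCoeff (T i)) * ∏ i, ∏ j ∈ T i, z i j := by
  simp only [one_sub_prod_one_sub, Finset.prod_univ_sum, Fintype.piFinset_univ,
    Finset.prod_mul_distrib]

section Sampling

variable {ι κ α : Type*} [Fintype ι] [Fintype κ]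

lemma ite_forall_exists_eq_prod (cell : ι × κ → α) {M : ℕ} (X : Fin M → α) :
    (if ∀ i, ∃ j, ∀ a, X a ≠ cell (i, j) then (1 : ℝ) else 0) =
      ∏ i, (1 - ∏ j, (1 - ∏ a, if X a = cell (i, j) then (0 : ℝ) else 1)) := by
  have hz : ∀ i j, (∏ a, if X a = cell (i, j) then (0 : ℝ) else 1) =
      if ∀ a, X a ≠ cell (i, j) then 1 else 0 := by
    intro i j
    split_ifs with h
    · exact Finset.prod_eq_one fun a _ => if_neg (h a)
    · push Not at h
      obtain ⟨a, ha⟩ := h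
      exact Finset.prod_eq_zero (Finset.mem_univ a) (if_pos ha)
  simp only [hz]
  split_ifs with h
  · refine (Finset.prod_eq_one fun i _ => ?_).symm
    obtain ⟨j, hj⟩ := h i
    rw [Finset.prod_eq_zero (Finset.mem_univ j), sub_zero]
    rw [if_pos hj, sub_self]
  · push Not at h
    obtain ⟨i, hi⟩ := h
    refine (Finset.prod_eq_zero (Finset.mem_univ i) ?_).symm
    rw [Finset.prod_eq_one, sub_self]
    intro j _
    rw [if_neg, sub_zero]
    push Not
    exact hi j

variable [Fintype α]

/-- The probability that, among `M` independent samples from `w`, every `i` has some `j` for which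
`cell (i, j)` is never drawn. -/
noncomputable def missProb (cell : ι × κ → α) (w : α → ℝ) (M : ℕ) : ℝ :=
  ∑ X : Fin M → α, if ∀ i, ∃ j, ∀ a, X a ≠ cell (i, j) then ∏ a, w (X a) else 0

lemma missProb_nonneg (cell : ι × κ → α) {w : α → ℝ} (hw : ∀ x, 0 ≤ w x) (M : ℕ) :
    0 ≤ missProb cell w M := by
  refine Finset.sum_nonneg fun X _ => ?_
  split_ifs
  · exact Finset.prod_nonneg fun a _ => hw _
  · exact le_rfl

lemma missProb_antitone (cell : ι × κ → α) {w : α → ℝ} (hw : ∀ x, 0 ≤ w x)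
    (hw1 : ∑ x, w x = 1) : Antitone (missProb cell w) := by
  refine antitone_nat_of_succ_le fun M => ?_
  unfold missProb
  rw [← (Fin.consEquiv fun _ : Fin (M + 1) => α).sum_comp, Fintype.sum_prod_type]
  calc _ ≤ ∑ x : α, ∑ X : Fin M → α,
        w x * (if ∀ i, ∃ j, ∀ a, X a ≠ cell (i, j) then ∏ a, w (X a) else 0) := by
        refine Finset.sum_le_sum fun x _ => Finset.sum_le_sum fun X _ => ?_
        by_cases h : ∀ i, ∃ j, ∀ a, X a ≠ cell (i, j)
        · rw [if_pos h]
          split_ifs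
          · simp [Fin.consEquiv, Fin.prod_univ_succ]
          · exact mul_nonneg (hw _) (Finset.prod_nonneg fun a _ => hw _)
        · rw [if_neg h, if_neg, mul_zero]
          intro h'
          refine h fun i => ?_
          obtain ⟨j, hj⟩ := h' i
          exact ⟨j, fun a => by simpa [Fin.consEquiv] using hj a.succ⟩
    _ = _ := by
        simp only [← Finset.mul_sum]
        rw [← Finset.sum_mul, hw1, one_mul]

lemma sum_mul_prod_avoid {cell : ι × κ → α} (hcell : cell.Injective) {w : α → ℝ}
    (hw1 : ∑ x, w x = 1) (T : ι → Finset κ) :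
    ∑ x, w x * ∏ i, ∏ j ∈ T i, (if x = cell (i, j) then (0 : ℝ) else 1) =
      1 - ∑ i, ∑ j ∈ T i, w (cell (i, j)) := by
  have hx : ∀ x, ∏ i, ∏ j ∈ T i, (if x = cell (i, j) then (0 : ℝ) else 1) =
      1 - ∑ i, ∑ j ∈ T i, (if x = cell (i, j) then (1 : ℝ) else 0) := by
    intro x
    rw [Finset.prod_sigma', Finset.sum_sigma']
    by_cases h : ∃ q ∈ univ.sigma T, x = cell (q.1, q.2)
    · obtain ⟨q, hq, hxq⟩ := h
      rw [Finset.prod_eq_zero (M₀ := ℝ) hq (by exact if_pos hxq), Finset.sum_eq_single_of_mem q hq, if_pos hxq,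
        sub_self]
      rintro ⟨i, j⟩ _ hne
      refine if_neg fun h => hne ?_
      have := hcell (h.symm.trans hxq)
      obtain ⟨i', j'⟩ := q
      simp_all
    · push Not at h
      rw [Finset.prod_eq_one fun q hq => if_neg (h q hq),
        Finset.sum_eq_zero fun q hq => if_neg (h q hq), sub_zero]
  simp only [hx, mul_sub, mul_one, Finset.sum_sub_distrib, hw1]
  congr 1
  simp only [Finset.mul_sum]
  rw [Finset.sum_comm]
  refine Finset.sum_congr rfl fun i _ => ?_
  rw [Finset.sum_comm]
  simp

lemma missProb_eq {cell : ι × κ → α} (hcell : cell.Injective) {w : α → ℝ}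
    (hw1 : ∑ x, w x = 1) (M : ℕ) :
    missProb cell w M = ∑ T : ι → Finset κ, (∏ i, unionCoeff (T i)) *
      (1 - ∑ i, ∑ j ∈ T i, w (cell (i, j))) ^ M := by
  have h : ∀ X : Fin M → α,
      (if ∀ i, ∃ j, ∀ a, X a ≠ cell (i, j) then ∏ a, w (X a) else 0) =
      ∑ T : ι → Finset κ, (∏ i, unionCoeff (T i)) *
        ∏ a, (w (X a) * ∏ i, ∏ j ∈ T i, if X a = cell (i, j) then (0 : ℝ) else 1) := by
    intro X
    rw [← mul_boole, mul_comm, ite_forall_exists_eq_prod, prod_one_sub_prod_one_sub,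
      Finset.sum_mul]
    refine Finset.sum_congr rfl fun T _ => ?_
    rw [mul_assoc]
    congr 1
    rw [Finset.prod_mul_distrib, mul_comm]
    congr 1
    rw [Finset.prod_comm]
    refine Finset.prod_congr rfl fun i _ => ?_
    rw [Finset.prod_comm]
  unfold missProb
  simp only [h]
  rw [Finset.sum_comm]
  refine Finset.sum_congr rfl fun T _ => ?_
  rw [← Finset.mul_sum, ← sum_mul_prod_avoid hcell hw1 T, Fintype.sum_pow]

/-- Poissonization: with a Poisson number of samples the cell counts become independent. -/
lemma hasSum_missProb {cell : ι × κ → α} (hcell : cell.Injective) {w : α → ℝ}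
    (hw1 : ∑ x, w x = 1) (r : ℝ) :
    HasSum (fun M : ℕ => r ^ M / M.factorial * missProb cell w M)
      (Real.exp r * ∏ i, (1 - ∏ j, (1 - Real.exp (-(r * w (cell (i, j))))))) := by
  have h : Real.exp r * ∏ i, (1 - ∏ j, (1 - Real.exp (-(r * w (cell (i, j)))))) =
      ∑ T : ι → Finset κ, (∏ i, unionCoeff (T i)) *
        Real.exp (r * (1 - ∑ i, ∑ j ∈ T i, w (cell (i, j)))) := by
    rw [prod_one_sub_prod_one_sub, Finset.mul_sum]
    refine Finset.sum_congr rfl fun T _ => ?_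
    simp only [← Real.exp_sum]
    rw [mul_left_comm, ← Real.exp_add]
    congr 2
    simp only [Finset.sum_neg_distrib, ← Finset.mul_sum]
    ring
  rw [h]
  simp only [missProb_eq hcell hw1, Finset.mul_sum]
  refine hasSum_sum fun T _ => ?_
  have h1 := (NormedSpace.expSeries_div_hasSum_exp
    (r * (1 - ∑ i, ∑ j ∈ T i, w (cell (i, j))))).mul_left (∏ i, unionCoeff (T i))
  rw [← Real.exp_eq_exp_ℝ] at h1
  refine h1.congr_fun ?_
  intro M
  rw [mul_pow]
  ring

lemma hasSum_pow_div_factorial_mul_self (r : ℝ) :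
    HasSum (fun M : ℕ => r ^ M / M.factorial * M) (r * Real.exp r) := by
  rw [← hasSum_nat_add_iff' 1]
  have h1 := (NormedSpace.expSeries_div_hasSum_exp r).mul_left r
  rw [← Real.exp_eq_exp_ℝ] at h1
  simp only [Finset.range_one, Finset.sum_singleton, Nat.cast_zero, mul_zero, sub_zero]
  refine h1.congr_fun fun M => ?_
  rw [Nat.factorial_succ]
  push_cast
  field_simp
  ring

lemma missProb_le {cell : ι × κ → α} (hcell : cell.Injective) {w : α → ℝ}
    (hw : ∀ x, 0 ≤ w x) (hw1 : ∑ x, w x = 1) {m : ℕ} (hm : 0 < m) {c : ℝ} (hc : 0 ≤ c) :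
    (1 - c) * missProb cell w m ≤
      ∏ i, (1 - ∏ j, (1 - Real.exp (-(c * m * w (cell (i, j)))))) := by
  have hm' : (0 : ℝ) < m := by exact_mod_cast hm
  have hexp := NormedSpace.expSeries_div_hasSum_exp (c * (m : ℝ))
  rw [← Real.exp_eq_exp_ℝ] at hexp
  have hlow := (hexp.sub ((hasSum_pow_div_factorial_mul_self (c * (m : ℝ))).div_const
    (m : ℝ))).mul_right (missProb cell w m)
  have hle := hasSum_le (fun M => ?_) hlow (hasSum_missProb hcell hw1 (c * (m : ℝ)))
  · have he := Real.exp_pos (c * (m : ℝ))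
    refine le_of_mul_le_mul_left (le_trans (le_of_eq ?_) hle) he
    field_simp
  · have hq : 0 ≤ (c * (m : ℝ)) ^ M / M.factorial := by positivity
    have hf := missProb_nonneg cell hw M
    have hg := missProb_nonneg cell hw m
    have key : (1 - (M : ℝ) / m) * missProb cell w m ≤ missProb cell w M := by
      rcases le_total M m with h | h
      · have h1 : (1 - (M : ℝ) / m) ≤ 1 := by
          have : 0 ≤ (M : ℝ) / m := by positivity
          linarith
        exact (mul_le_of_le_one_left hg h1).trans (missProb_antitone cell hw hw1 h)
      · have h1 : 1 - (M : ℝ) / m ≤ 0 := by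
          rw [sub_nonpos, one_le_div hm']
          exact_mod_cast h
        exact (mul_nonpos_of_nonpos_of_nonneg h1 hg).trans hf
    calc _ = (c * (m : ℝ)) ^ M / M.factorial * ((1 - (M : ℝ) / m) * missProb cell w m) := by ring
      _ ≤ _ := mul_le_mul_of_nonneg_left key hq

end Sampling

lemma one_sub_pow_le_mul_exp_neg {k : ℕ} {x : ℝ} (hx : 0 ≤ x) :
    1 - (1 - Real.exp (-x)) ^ k ≤ k * Real.exp (-x) := by
  have h0 := Real.exp_pos (-x)
  have h1 : Real.exp (-x) ≤ 1 := Real.exp_le_one_iff.mpr (by linarith)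
  have := one_add_mul_le_pow (a := -Real.exp (-x)) (by linarith) k
  rw [← sub_eq_add_neg 1 (Real.exp (-x))] at this
  linarith

lemma one_sub_pow_le_exp_neg_sub {k : ℕ} {x : ℝ} (hx : 0 ≤ x) :
    1 - (1 - Real.exp (-x)) ^ k ≤ Real.exp (-(x - ((k : ℝ) - 1))) := by
  have h1 : (k : ℝ) ≤ Real.exp ((k : ℝ) - 1) := by
    linarith [Real.add_one_le_exp ((k : ℝ) - 1)]
  calc _ ≤ k * Real.exp (-x) := one_sub_pow_le_mul_exp_neg hx
    _ ≤ Real.exp ((k : ℝ) - 1) * Real.exp (-x) := by gcongr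
    _ = _ := by rw [← Real.exp_add]; ring_nf

lemma tangent_le_pow {k : ℕ} (hk : 0 < k) {s y : ℝ} (hs : 0 < s) (hy : 0 ≤ y) :
    k * s ^ (k - 1) * y - (k - 1) * s ^ k ≤ y ^ k := by
  have h := one_add_mul_le_pow (a := y / s - 1)
    (by have : 0 ≤ y / s := by positivity
        linarith) k
  have h2 := mul_le_mul_of_nonneg_right h (pow_nonneg hs.le k)
  rw [← mul_pow] at h2
  obtain ⟨l, rfl⟩ := Nat.exists_eq_add_one.mpr hk
  simp only [Nat.add_sub_cancel]
  have e1 : (1 + (y / s - 1)) * s = y := by field_simp; ring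
  rw [e1] at h2
  refine le_trans (le_of_eq ?_) h2
  push_cast
  field_simp
  ring

lemma one_sub_pow_le_exp_neg_tangent {k : ℕ} (hk : 2 ≤ k) {s x : ℝ} (hs : 0 < s) (hs1 : s ≤ 1)
    (hx : 0 ≤ x) :
    1 - (1 - Real.exp (-x)) ^ k ≤
      Real.exp (-(2 / 5 * s ^ (k - 1) * x - ((k : ℝ) - 1) * s ^ k)) := by
  have hk2 : (2 : ℝ) ≤ k := by exact_mod_cast hk
  have hk0 : (0 : ℝ) < k := by linarith
  rcases le_total x (2 * k) with h | h
  · have hq : 2 / 5 * x / k ≤ 1 - Real.exp (-x) := by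
      have h1 : Real.exp (-x) ≤ 1 / (1 + x) := by
        rw [Real.exp_neg, ← one_div]
        exact one_div_le_one_div_of_le (by linarith) (by linarith [Real.add_one_le_exp x])
      have h2 : 2 / 5 * x / k ≤ 1 - 1 / (1 + x) := by
        rw [one_sub_div (by positivity), div_le_div_iff₀ hk0 (by positivity)]
        nlinarith
      linarith
    have h3 := tangent_le_pow (by omega : 0 < k) hs (by positivity : 0 ≤ 2 / 5 * x / k)
    have h4 : (2 / 5 * x / k) ^ k ≤ (1 - Real.exp (-x)) ^ k :=
      pow_le_pow_left₀ (by positivity) hq k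
    have h5 : (k : ℝ) * s ^ (k - 1) * (2 / 5 * x / k) = 2 / 5 * s ^ (k - 1) * x := by
      field_simp
    rw [h5] at h3
    refine le_trans ?_ (Real.add_one_le_exp _)
    linarith
  · refine (one_sub_pow_le_exp_neg_sub hx).trans ?_
    rw [Real.exp_le_exp, neg_le_neg_iff]
    have h1 : s ^ (k - 1) * x ≤ x := mul_le_of_le_one_left hx (pow_le_one₀ hs.le hs1)
    have h2 : 0 ≤ ((k : ℝ) - 1) * s ^ k := mul_nonneg (by linarith) (by positivity)
    linarith

lemma prod_le_exp_neg_of_affine {ι : Type*} [Fintype ι] {φ : ℝ → ℝ} {x : ι → ℝ}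
    (hφ : ∀ i, 0 ≤ φ (x i)) {A B : ℝ} (h : ∀ i, φ (x i) ≤ Real.exp (-(A * x i - B))) :
    ∏ i, φ (x i) ≤ Real.exp (-(A * ∑ i, x i - Fintype.card ι * B)) := by
  calc _ ≤ ∏ i, Real.exp (-(A * x i - B)) :=
        Finset.prod_le_prod (fun i _ => hφ i) fun i _ => h i
    _ = _ := by
        rw [← Real.exp_sum]
        simp [Finset.sum_sub_distrib, Finset.mul_sum]

lemma exp_neg_le : Real.exp (-(144 / 25)) ≤ 1 / 250 := by
  have h1 : (2.7182 : ℝ) ≤ Real.exp 1 := by linarith [Real.exp_one_gt_d9]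
  have h2 : (250 : ℝ) ≤ Real.exp (144 / 25) := by
    calc (250 : ℝ) ≤ 2.7182 ^ 5 * (19 / 25 + 1) := by norm_num
      _ ≤ Real.exp 1 ^ 5 * Real.exp (19 / 25) := by
          gcongr
          exact Real.add_one_le_exp _
      _ = _ := by rw [← Real.exp_nat_mul, ← Real.exp_add]; norm_num
  rw [Real.exp_neg, ← one_div]
  exact one_div_le_one_div_of_le (by norm_num) h2

lemma prod_one_sub_pow_le {n k : ℕ} (hk : 0 < k) {t : ℝ} (ht : 0 < t) (ht1 : t ≤ 1)
    (hnt : n * t ^ k = 1) {x : Fin n → ℝ} (hx : ∀ i, 0 ≤ x i)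
    (hsum : 6 * k * (n * t) ≤ ∑ i, x i) :
    ∏ i, (1 - (1 - Real.exp (-x i)) ^ k) ≤ 1 / 250 := by
  refine le_trans ?_ exp_neg_le
  have hk1 : (1 : ℝ) ≤ k := by exact_mod_cast hk
  have hφ : ∀ i, 0 ≤ 1 - (1 - Real.exp (-x i)) ^ k := fun i => by
    have h0 := Real.exp_pos (-x i)
    have h1 : Real.exp (-x i) ≤ 1 := Real.exp_le_one_iff.mpr (by linarith [hx i])
    linarith [pow_le_one₀ (n := k) (by linarith : 0 ≤ 1 - Real.exp (-x i)) (by linarith)]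
  by_cases hcase : 2 ≤ k ∧ 12 / 5 * t ≤ 1
  · obtain ⟨hk2, hs1⟩ := hcase
    have hs : 0 < 12 / 5 * t := by positivity
    refine (prod_le_exp_neg_of_affine (φ := fun x => 1 - (1 - Real.exp (-x)) ^ k) hφ
      fun i => one_sub_pow_le_exp_neg_tangent hk2 hs hs1 (hx i)).trans ?_
    rw [Real.exp_le_exp, neg_le_neg_iff, Fintype.card_fin]
    have h1 := mul_le_mul_of_nonneg_left hsum
      (by positivity : 0 ≤ 2 / 5 * (12 / 5 * t) ^ (k - 1))
    have hpow : (12 / 5 * t) ^ k = (12 / 5 * t) ^ (k - 1) * (12 / 5 * t) := by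
      rw [← pow_succ, Nat.sub_add_cancel hk]
    have h2 : (144 : ℝ) / 25 ≤ (12 / 5) ^ k := by
      calc (144 : ℝ) / 25 = (12 / 5) ^ 2 := by norm_num
        _ ≤ _ := pow_le_pow_right₀ (by norm_num) hk2
    have h3 : (n : ℝ) * (12 / 5 * t) ^ k = (12 / 5) ^ k := by
      rw [mul_pow]
      linear_combination (12 / 5 : ℝ) ^ k * hnt
    have h4 : 2 / 5 * (12 / 5 * t) ^ (k - 1) * (6 * k * (n * t)) =
        k * (n * (12 / 5 * t) ^ k) := by
      rw [hpow]; ring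
    rw [h4] at h1
    linarith
  · refine (prod_le_exp_neg_of_affine (φ := fun x => 1 - (1 - Real.exp (-x)) ^ k) (A := 1)
      hφ fun i => (one_sub_pow_le_exp_neg_sub (hx i)).trans_eq (by rw [one_mul])).trans ?_
    rw [Real.exp_le_exp, neg_le_neg_iff, Fintype.card_fin, one_mul]
    have hn0 : (0 : ℝ) ≤ n := Nat.cast_nonneg n
    have h1 : 1 ≤ (n : ℝ) * t := by
      rw [← hnt]
      exact mul_le_mul_of_nonneg_left (pow_le_of_le_one ht.le ht1 hk.ne') hn0
    have h2 : (k : ℝ) - 1 ≤ 12 / 5 * t * ((k : ℝ) - 1) := by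
      rcases Nat.lt_or_ge k 2 with h | h
      · obtain rfl : k = 1 := by omega
        simp
      · have : 1 < 12 / 5 * t := by
          by_contra h'
          exact hcase ⟨h, not_lt.mp h'⟩
        nlinarith
    have h3 := mul_le_mul_of_nonneg_left h2 hn0
    nlinarith

end BirthdayHypergraph

/-- Classical birthday paradox, hypergraph version (Lemma 7.8): with
m ≥ 10·k·n^{(k−1)/k}/ε samples from the distribution assigning mass p_i to each
pair (i, j) ∈ [n+1] × [k], the probability that every i ∈ [n] has some j ∈ [k]
with no sample equal to (i, j) is at most 1/100. -/
theorem classical_birthday_hypergraph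
    (n k : ℕ) (hn : 0 < n) (hk : 0 < k)
    (p : Fin (n + 1) → ℝ) (hp0 : ∀ i, 0 ≤ p i) (hp1 : ∑ i, p i = 1 / (k : ℝ))
    (ε : ℝ) (hε : ε = ∑ i : Fin n, p i.castSucc) (hεpos : 0 < ε)
    (m : ℕ) (hm : 0 < m)
    (hm2 : 10 * (k : ℝ) * (n : ℝ) ^ (((k : ℝ) - 1) / (k : ℝ)) / ε ≤ (m : ℝ)) :
    ∑ X : Fin m → Fin (n + 1) × Fin k,
      (if ∀ i : Fin n, ∃ j : Fin k,
          (Finset.univ.filter (fun a => X a = (i.castSucc, j))).card = 0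
       then ∏ a, p (X a).1 else 0) ≤ 1 / 100 := by
  have hkR : (0 : ℝ) < k := by exact_mod_cast hk
  have hnR : (0 : ℝ) < n := by exact_mod_cast hn
  have hn1 : (1 : ℝ) ≤ n := by exact_mod_cast hn
  set cell : Fin n × Fin k → Fin (n + 1) × Fin k := fun q => (q.1.castSucc, q.2) with hcell
  have hinj : cell.Injective := by
    rintro ⟨i, j⟩ ⟨i', j'⟩ h
    simpa [hcell] using h
  have hw1 : ∑ x : Fin (n + 1) × Fin k, p x.1 = 1 := by
    rw [Fintype.sum_prod_type]
    simp only [Finset.sum_const, Finset.card_univ, Fintype.card_fin, nsmul_eq_mul,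
      ← Finset.mul_sum, hp1]
    field_simp
  have hmain := BirthdayHypergraph.missProb_le hinj (w := fun x => p x.1) (fun x => hp0 x.1) hw1
    hm (c := 3 / 5) (by norm_num)
  have hlhs : ∑ X : Fin m → Fin (n + 1) × Fin k,
      (if ∀ i : Fin n, ∃ j : Fin k,
          (Finset.univ.filter (fun a => X a = (i.castSucc, j))).card = 0
       then ∏ a, p (X a).1 else 0) = BirthdayHypergraph.missProb cell (fun x => p x.1) m := by
    unfold BirthdayHypergraph.missProb
    refine Finset.sum_congr rfl fun X _ => ?_
    simp [hcell, Finset.card_eq_zero, Finset.filter_eq_empty_iff]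
  rw [hlhs]
  have hnt : (n : ℝ) * ((n : ℝ) ^ (-(1 / (k : ℝ)))) ^ k = 1 := by
    rw [← Real.rpow_natCast, ← Real.rpow_mul hnR.le]
    have : -(1 / (k : ℝ)) * k = -1 := by field_simp
    rw [this, Real.rpow_neg_one, mul_inv_cancel₀ hnR.ne']
  have hpow : (n : ℝ) ^ (((k : ℝ) - 1) / (k : ℝ)) = n * (n : ℝ) ^ (-(1 / (k : ℝ))) := by
    rw [show ((k : ℝ) - 1) / k = 1 + -(1 / (k : ℝ)) by field_simp; ring, Real.rpow_add hnR,
      Real.rpow_one]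
  have hprod := BirthdayHypergraph.prod_one_sub_pow_le hk
    (Real.rpow_pos_of_pos hnR _)
    (Real.rpow_le_one_of_one_le_of_nonpos hn1 (by simp)) hnt
    (x := fun i : Fin n => 3 / 5 * m * p i.castSucc)
    (fun i => mul_nonneg (by positivity) (hp0 _)) (by
      rw [← Finset.mul_sum, ← hε, ← hpow]
      rw [div_le_iff₀ hεpos] at hm2
      linarith)
  simp only [hcell, Finset.prod_const, Finset.card_univ, Fintype.card_fin] at hmain
  linarith
end

section
/- Let G = (V, E) be a finite k-uniform hypergraph (every edge e ∈ E is a k-element subset of V), let ε > 0, and let μ : V → ℝ_{≥0} be a weight function such that every vertex cover C of G satisfies Σ_{v∈C} μ(v) ≥ ε. Then there exist nonnegative reals (λ_e)_{e∈E} such that Σ_{e∈E : v∈e} λ_e ≤ μ(v) for every v ∈ V, Σ_{e∈E} λ_e ≥ ε/k, and the number of edges e with λ_e ≠ 0 is at most |V|. -/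
open scoped Classical

/-- Greedy saturation: edges are treated one at a time, each receiving the largest weight its
vertices still allow. Every edge then contains a saturated vertex, and each edge of nonzero weight
has saturated a new vertex. -/
theorem exists_saturating_weight {V : Type*} [Fintype V] [DecidableEq V]
    (μ : V → ℝ) (hμ : ∀ v, 0 ≤ μ v) (E : Finset (Finset V)) (hE : ∀ e ∈ E, e.Nonempty) :
    ∃ lam : Finset V → ℝ,
      (∀ e, 0 ≤ lam e) ∧ (∀ e ∉ E, lam e = 0) ∧
      (∀ v : V, ∑ e ∈ E.filter (fun e => v ∈ e), lam e ≤ μ v) ∧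
      (∀ e ∈ E, ∃ v ∈ e, ∑ f ∈ E.filter (fun f => v ∈ f), lam f = μ v) ∧
      (E.filter (fun e => lam e ≠ 0)).card ≤
        (Finset.univ.filter
          (fun v : V => ∑ f ∈ E.filter (fun f => v ∈ f), lam f = μ v)).card := by
  induction E using Finset.induction_on with
  | empty => exact ⟨fun _ => 0, by simp, by simp, by simpa using hμ, by simp, by simp⟩
  | insert e s hes ih =>
    obtain ⟨lam, h0, hs, hle, htight, hcard⟩ :=
      ih fun f hf => hE f (Finset.mem_insert_of_mem hf)
    obtain ⟨w, hwe, hw⟩ := Finset.exists_min_image e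
      (fun v => μ v - ∑ f ∈ s.filter (fun f => v ∈ f), lam f)
      (hE e (Finset.mem_insert_self e s))
    set load : V → ℝ := fun v => ∑ f ∈ s.filter (fun f => v ∈ f), lam f with hload
    set m : ℝ := μ w - load w with hm
    have hm0 : 0 ≤ m := sub_nonneg.mpr (hle w)
    have hupd : ∀ f ∈ s, Function.update lam e m f = lam f := fun f hf =>
      Function.update_of_ne (ne_of_mem_of_not_mem hf hes) _ _
    have hsum : ∀ v, ∑ f ∈ (insert e s).filter (fun f => v ∈ f), Function.update lam e m f =
        load v + if v ∈ e then m else 0 := by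
      intro v
      rw [Finset.sum_filter, Finset.sum_insert hes, Function.update_self, add_comm, hload]
      simp only [Finset.sum_filter]
      congr 1
      exact Finset.sum_congr rfl fun f hf => by rw [hupd f hf]
    have hmono : ∀ v, load v = μ v → (load v + if v ∈ e then m else 0) = μ v := by
      intro v hv
      split_ifs with hve
      · have := hw v hve
        linarith
      · simpa using hv
    have hfilter : s.filter (fun f => Function.update lam e m f ≠ 0) =
        s.filter (fun f => lam f ≠ 0) :=
      Finset.filter_congr fun f hf => by rw [hupd f hf]
    have hw_tight : (load w + if w ∈ e then m else 0) = μ w := by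
      rw [if_pos hwe]; ring
    refine ⟨Function.update lam e m, fun f => ?_, fun f hf => ?_, fun v => ?_, fun f hf => ?_, ?_⟩
    · by_cases hfe : f = e
      · subst hfe; simpa using hm0
      · simpa [hfe] using h0 f
    · rw [Finset.mem_insert, not_or] at hf
      rw [Function.update_of_ne hf.1]
      exact hs f hf.2
    · rw [hsum v]
      split_ifs with hve
      · have := hw v hve
        linarith
      · simpa using hle v
    · simp only [hsum]
      rcases Finset.mem_insert.mp hf with rfl | hf
      · exact ⟨w, hwe, hw_tight⟩
      · obtain ⟨v, hvf, hv⟩ := htight f hf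
        exact ⟨v, hvf, hmono v hv⟩
    · simp only [hsum]
      rw [Finset.filter_insert, Function.update_self, hfilter]
      have hsub : Finset.univ.filter (fun v => load v = μ v) ⊆
          Finset.univ.filter (fun v => (load v + if v ∈ e then m else 0) = μ v) :=
        Finset.monotone_filter_right _ fun v _ => hmono v
      split_ifs with hne
      · refine (Finset.card_insert_le _ _).trans (Nat.succ_le_of_lt (hcard.trans_lt ?_))
        refine Finset.card_lt_card (Finset.ssubset_iff_of_subset hsub |>.mpr ⟨w, ?_, ?_⟩)
        · simpa using hw_tight
        · simpa using fun h : load w = μ w => hne (sub_eq_zero.mpr h.symm)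
      · exact hcard.trans (Finset.card_le_card hsub)

/-- LP duality plus Carathéodory step in Lemma 2.2: if every vertex cover of a
k-uniform hypergraph has μ-weight at least ε, then there is a fractional matching
of total weight at least ε/k supported on at most |V| edges. -/
theorem hypergraph_fractional_matching
    {V : Type*} [Fintype V] [DecidableEq V]
    (k : ℕ) (hk : 0 < k)
    (E : Finset (Finset V)) (hE : ∀ e ∈ E, e.card = k)
    (ε : ℝ) (hε : 0 < ε)
    (μ : V → ℝ) (hμ : ∀ v, 0 ≤ μ v)
    (hcover : ∀ C : Finset V, (∀ e ∈ E, ∃ v ∈ e, v ∈ C) → ε ≤ ∑ v ∈ C, μ v) :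
    ∃ lam : Finset V → ℝ,
      (∀ e, 0 ≤ lam e) ∧ (∀ e ∉ E, lam e = 0) ∧
      (∀ v : V, ∑ e ∈ E.filter (fun e => v ∈ e), lam e ≤ μ v) ∧
      (ε / (k : ℝ) ≤ ∑ e ∈ E, lam e) ∧
      (E.filter (fun e => lam e ≠ 0)).card ≤ Fintype.card V := by
  obtain ⟨lam, h0, hoff, hle, htight, hcard⟩ := exists_saturating_weight μ hμ E fun e he =>
    Finset.card_pos.mp (by rw [hE e he]; exact hk)
  refine ⟨lam, h0, hoff, hle, ?_, hcard.trans (Finset.card_le_univ _)⟩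
  set C : Finset V :=
    Finset.univ.filter fun v => ∑ e ∈ E.filter (fun e => v ∈ e), lam e = μ v with hC
  have hk' : (0 : ℝ) < k := Nat.cast_pos.mpr hk
  rw [div_le_iff₀ hk']
  calc ε ≤ ∑ v ∈ C, μ v := hcover C fun e he => by simpa [hC] using htight e he
    _ = ∑ v ∈ C, ∑ e ∈ E.filter (fun e => v ∈ e), lam e :=
      Finset.sum_congr rfl fun v hv => ((Finset.mem_filter.mp hv).2).symm
    _ ≤ ∑ v, ∑ e ∈ E.filter (fun e => v ∈ e), lam e :=
      Finset.sum_le_sum_of_subset_of_nonneg (Finset.subset_univ _)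
        fun v _ _ => Finset.sum_nonneg fun e _ => h0 e
    _ = ∑ e ∈ E, ∑ v : V, if v ∈ e then lam e else 0 := by
      simp only [Finset.sum_filter]
      exact Finset.sum_comm
    _ = (∑ e ∈ E, lam e) * k := by
      rw [Finset.sum_mul]
      refine Finset.sum_congr rfl fun e he => ?_
      simp [hE e he, mul_comm]
end

section
/- Let G = (U, V, E) be a complete bipartite graph with an edge labeling φ : E → {0, 1}. If (G, φ) has an alternating 2k-cycle for some integer k ≥ 2, then it also has an alternating 4-cycle. -/
/-- Lemma 4.15: if a complete bipartite graph with an edge labeling φ has an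
alternating 2k-cycle (k ≥ 2), then it has an alternating 4-cycle.
Here x i (i < k) are the U-vertices and y i the V-vertices of the cycle:
φ(x i, y i) = 0 and φ(x ((i+1) mod k), y i) = 1. -/
theorem alternating_cycle_to_four_cycle
    {U V : Type*} (φ : U → V → Bool)
    (k : ℕ) (hk : 2 ≤ k) (x : ℕ → U) (y : ℕ → V)
    (h0 : ∀ i < k, φ (x i) (y i) = false)
    (h1 : ∀ i < k, φ (x ((i + 1) % k)) (y i) = true) :
    ∃ (x₁ x₂ : U) (y₁ y₂ : V),
      φ x₁ y₁ = false ∧ φ x₂ y₁ = true ∧ φ x₂ y₂ = false ∧ φ x₁ y₂ = true := by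
  by_contra hno
  have key : ∀ i < k, φ (x ((i + 1) % k)) (y 0) = true := by
    intro i
    induction i with
    | zero => exact h1 0
    | succ i ih =>
      intro hi
      have hprev := ih (by omega)
      rw [Nat.mod_eq_of_lt hi] at hprev
      by_contra hne
      exact hno ⟨_, _, _, _, Bool.eq_false_of_not_eq_true hne, hprev, h0 _ hi, h1 _ hi⟩
  have hlast := key (k - 1) (by omega)
  rw [Nat.sub_add_cancel (by omega), Nat.mod_self, h0 0 (by omega)] at hlast
  exact Bool.false_ne_true hlast
end

section
/- Let f : {0,1}ⁿ → {0,1} be a monotone decision list. Then there do not exist indices u₁, u₂, u₃, u₄ ∈ [n] such that f(e_{u₁} ∨ e_{u₂}) = f(e_{u₃} ∨ e_{u₄}) = 0 and f(e_{u₂} ∨ e_{u₃}) = f(e_{u₄} ∨ e_{u₁}) = 1. -/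
/-- `f` is a monotone decision list: there are a permutation `π` of `Fin n` and a
value vector `ν ∈ {0,1}^{n+1}` such that `f x = ν j` where `j` is the smallest index
with `x (π j) = true`, and `f 0ⁿ = ν (n+1)`. -/
def IsMonotoneDL (n : ℕ) (f : (Fin n → Bool) → Bool) : Prop :=
  ∃ (π : Equiv.Perm (Fin n)) (ν : Fin (n + 1) → Bool),
    (∀ (x : Fin n → Bool) (j : Fin n),
        x (π j) = true → (∀ j' : Fin n, j' < j → x (π j') = false) →
        f x = ν j.castSucc) ∧
    f (fun _ => false) = ν (Fin.last n)

/-- A monotone decision list evaluates a string with support `{a, b}` at whichever of `a`, `b`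
comes first in the list. -/
theorem IsMonotoneDL.exists_eq_min {n : ℕ} {f : (Fin n → Bool) → Bool} (hf : IsMonotoneDL n f) :
    ∃ (p : Fin n → Fin n) (g : Fin n → Bool), ∀ a b : Fin n,
      f (fun i => decide (i = a ∨ i = b)) = g (min (p a) (p b)) := by
  obtain ⟨π, ν, h, -⟩ := hf
  refine ⟨π.symm, fun j => ν j.castSucc, fun a b => h _ _ ?_ fun j hj => ?_⟩
  · rcases min_choice (π.symm a) (π.symm b) with hm | hm <;> simp [hm]
  · obtain ⟨ha, hb⟩ := lt_min_iff.mp hj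
    simpa [← Equiv.eq_symm_apply] using And.intro ha.ne hb.ne

/-- No monotone decision list admits an alternating labeled 4-cycle on pairs of
singleton-support strings: one cannot have f(e_{u₁}∨e_{u₂}) = f(e_{u₃}∨e_{u₄}) = 0
and f(e_{u₂}∨e_{u₃}) = f(e_{u₄}∨e_{u₁}) = 1. -/
theorem monotone_dl_no_alternating
    (n : ℕ) (f : (Fin n → Bool) → Bool) (hf : IsMonotoneDL n f) :
    ¬ ∃ u₁ u₂ u₃ u₄ : Fin n,
      f (fun i => decide (i = u₁ ∨ i = u₂)) = false ∧
      f (fun i => decide (i = u₃ ∨ i = u₄)) = false ∧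
      f (fun i => decide (i = u₂ ∨ i = u₃)) = true ∧
      f (fun i => decide (i = u₄ ∨ i = u₁)) = true := by
  obtain ⟨p, g, h⟩ := hf.exists_eq_min
  rintro ⟨u₁, u₂, u₃, u₄, h₁₂, h₃₄, h₂₃, h₄₁⟩
  rw [h] at h₁₂ h₃₄ h₂₃ h₄₁
  grind
end

section
/- Let y⁽¹⁾, …, y⁽ᵐ⁾ ∈ {0,1}ⁿ be strings such that for every k ∈ [m], supp(y⁽ᵏ⁾) does not contain the intersection ⋂_{j ∈ [m], j ≠ k} supp(y⁽ʲ⁾) (where the empty intersection is [n]). Then the set {y⁽¹⁾, …, y⁽ᵐ⁾} is shattered by the class of monotone conjunctions: for every sequence of bits b⁽¹⁾, …, b⁽ᵐ⁾ ∈ {0,1} there exists a set E ⊆ [n] such that the function f(x) = ⋀_{i∈E} x_i satisfies f(y⁽ᵏ⁾) = b⁽ᵏ⁾ for all k ∈ [m]. -/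
/-- If no string's support contains the intersection of the supports of the others,
then the strings are shattered by the class of monotone conjunctions. -/
theorem shattered_of_no_containment
    (n m : ℕ) (y : Fin m → Fin n → Bool)
    (hcond : ∀ k : Fin m,
      ¬ ((Finset.univ.erase k).inf (fun j => Finset.univ.filter fun i => y j i = true)
          ⊆ Finset.univ.filter fun i => y k i = true)) :
    ∀ b : Fin m → Bool, ∃ E : Finset (Fin n),
      ∀ k : Fin m, ((∀ i ∈ E, y k i = true) ↔ b k = true) := by
  intro b
  have hwitness : ∀ k, ∃ i, (∀ j, j ≠ k → y j i = true) ∧ ¬ y k i = true := by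
    intro k
    obtain ⟨i, hi, hik⟩ := Finset.not_subset.mp (hcond k)
    refine ⟨i, fun j hj => ?_, by simpa using hik⟩
    have hle := Finset.inf_le (f := fun j => Finset.univ.filter fun i => y j i = true)
      (Finset.mem_erase.mpr ⟨hj, Finset.mem_univ j⟩)
    exact (Finset.mem_filter.mp (hle hi)).2
  choose w hw_other hw_self using hwitness
  refine ⟨(Finset.univ.filter fun k => ¬ b k = true).image w, fun k => ⟨fun h => ?_, ?_⟩⟩
  · by_contra hb
    exact hw_self k (h _ (Finset.mem_image_of_mem w (by simpa using hb)))
  · intro hb i hi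
    obtain ⟨j, hj, rfl⟩ := Finset.mem_image.mp hi
    refine hw_other j k ?_
    rintro rfl
    exact (Finset.mem_filter.mp hj).2 hb
end

section
/- Let n ≥ 2 be an integer and 0 < ε ≤ 1 a real number with 100·ε·ln n ≤ √n. Let 𝒟 be a probability distribution over [n] and let S be the set formed by m independent samples from 𝒟, where m is an integer with m ≥ √n/ε. Then with probability at least 1 − n^{−99}, every interval [a, b] ⊆ [n] (a ≤ b) with 𝒟([a, b]) ≥ 100·ε·ln n/√n contains at least one element of S. -/
open scoped Classical

/-- The probability that none of `m` independent samples falls into `T`. -/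
lemma sum_prod_missing {α : Type*} [Fintype α] (D : α → ℝ) (hD1 : ∑ i, D i = 1)
    (m : ℕ) (T : Finset α) :
    ∑ X : Fin m → α, (if ∃ j, X j ∈ T then 0 else ∏ i, D (X i)) =
      (1 - ∑ i ∈ T, D i) ^ m := by
  have hmass : 1 - ∑ i ∈ T, D i = ∑ i, if i ∈ T then 0 else D i := by
    rw [← hD1, ← Finset.sum_filter_add_sum_filter_not Finset.univ (· ∈ T) D,
      Finset.filter_univ_mem, add_sub_cancel_left, Finset.sum_filter]
    exact Finset.sum_congr rfl fun i _ => by by_cases h : i ∈ T <;> simp [h]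
  rw [hmass, Fintype.sum_pow]
  refine Finset.sum_congr rfl fun X _ => ?_
  split_ifs with h
  · obtain ⟨j, hj⟩ := h
    exact (Finset.prod_eq_zero (Finset.mem_univ j) (by simp [hj])).symm
  · push Not at h
    exact Finset.prod_congr rfl fun i _ => by simp [h i]

/-- Union bound: `m` independent samples hit every member of a finite family of sets,
each of mass at least `p`, except with probability at most `#A * (1 - p) ^ m`. -/
lemma one_sub_card_mul_le_prob_hit {α ι : Type*} [Fintype α] (D : α → ℝ)
    (hD0 : ∀ i, 0 ≤ D i) (hD1 : ∑ i, D i = 1) (m : ℕ) (A : Finset ι) (T : ι → Finset α)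
    (p : ℝ) (hT : ∀ a ∈ A, p ≤ ∑ i ∈ T a, D i) :
    1 - A.card * (1 - p) ^ m ≤
      ∑ X : Fin m → α, (if ∀ a ∈ A, ∃ j, X j ∈ T a then ∏ i, D (X i) else 0) := by
  have htotal : ∑ X : Fin m → α, ∏ i, D (X i) = 1 := by
    rw [← Fintype.sum_pow, hD1, one_pow]
  have hmiss : ∑ a ∈ A, ∑ X : Fin m → α, (if ∃ j, X j ∈ T a then 0 else ∏ i, D (X i)) ≤
      A.card * (1 - p) ^ m := by
    rw [← nsmul_eq_mul]
    refine Finset.sum_le_card_nsmul _ _ _ fun a ha => ?_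
    rw [sum_prod_missing D hD1]
    have hle : ∑ i ∈ T a, D i ≤ 1 :=
      hD1 ▸ Finset.sum_le_univ_sum_of_nonneg hD0
    exact pow_le_pow_left₀ (by linarith) (by linarith [hT a ha]) m
  rw [Finset.sum_comm] at hmiss
  refine (sub_le_sub_left hmiss 1).trans ?_
  rw [← htotal, ← Finset.sum_sub_distrib]
  refine Finset.sum_le_sum fun X _ => ?_
  have hX : 0 ≤ ∏ i, D (X i) := Finset.prod_nonneg fun i _ => hD0 _
  have hterm : ∀ a ∈ A, (0 : ℝ) ≤ if ∃ j, X j ∈ T a then 0 else ∏ i, D (X i) :=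
    fun a _ => by split_ifs <;> simp [hX]
  split_ifs with h
  · linarith [Finset.sum_nonneg hterm]
  · push Not at h
    obtain ⟨a, ha, hmem⟩ := h
    have hsingle := Finset.single_le_sum hterm ha
    rw [if_neg (by simpa using hmem)] at hsingle
    linarith

/-- The miss probability of one set of mass `100 * ε * log n / √n`. -/
lemma one_sub_pow_le_inv_pow (n : ℕ) (hn : 2 ≤ n) (ε : ℝ) (hε0 : 0 < ε)
    (hcond : 100 * ε * Real.log n ≤ Real.sqrt n)
    (m : ℕ) (hm : Real.sqrt n / ε ≤ (m : ℝ)) :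
    (1 - 100 * ε * Real.log n / Real.sqrt n) ^ m ≤ ((n : ℝ) ^ 100)⁻¹ := by
  have hn0 : (0 : ℝ) < n := by positivity
  have hs : 0 < Real.sqrt n := Real.sqrt_pos.2 hn0
  have hlog : 0 ≤ Real.log n := Real.log_natCast_nonneg n
  set p := 100 * ε * Real.log n / Real.sqrt n with hp
  have hp0 : 0 ≤ p := by positivity
  have hp1 : p ≤ 1 := (div_le_one hs).2 hcond
  have hpm : 100 * Real.log n ≤ m * p := by
    calc 100 * Real.log n = Real.sqrt n / ε * p := by rw [hp]; field_simp
      _ ≤ m * p := mul_le_mul_of_nonneg_right hm hp0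
  calc (1 - p) ^ m ≤ Real.exp (-p) ^ m :=
        pow_le_pow_left₀ (by linarith) (Real.one_sub_le_exp_neg p) m
    _ = Real.exp (-(m * p)) := by rw [← Real.exp_nat_mul, mul_neg]
    _ ≤ Real.exp (-(100 * Real.log n)) := Real.exp_le_exp.2 (by linarith)
    _ = ((n : ℝ) ^ 100)⁻¹ := by
        rw [Real.exp_neg, show (100 : ℝ) = ((100 : ℕ) : ℝ) by norm_num, Real.exp_nat_mul,
          Real.exp_log hn0]

/-- For each left endpoint the heavy intervals all contain the shortest one, so at most `n`
intervals have to be hit in order to hit every heavy interval. -/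
lemma exists_shortest_heavy_interval (n : ℕ) (D : Fin n → ℝ) (p : ℝ) :
    ∃ (A : Finset (Fin n)) (r : Fin n → Fin n),
      (∀ a ∈ A, p ≤ ∑ i ∈ Finset.Icc a (r a), D i) ∧
      ∀ a b, p ≤ ∑ i ∈ Finset.Icc a b, D i → a ∈ A ∧ r a ≤ b := by
  have hmin : ∀ a : Fin n, ∃ c, (∃ b, p ≤ ∑ i ∈ Finset.Icc a b, D i) →
      p ≤ ∑ i ∈ Finset.Icc a c, D i ∧ ∀ b, p ≤ ∑ i ∈ Finset.Icc a b, D i → c ≤ b := by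
    intro a
    by_cases h : ∃ b, p ≤ ∑ i ∈ Finset.Icc a b, D i
    · obtain ⟨c, hc, hle⟩ := WellFounded.has_min (wellFounded_lt (α := Fin n))
        {b | p ≤ ∑ i ∈ Finset.Icc a b, D i} h
      exact ⟨c, fun _ => ⟨hc, fun b hb => not_lt.1 (hle b hb)⟩⟩
    · exact ⟨a, fun h' => absurd h' h⟩
  choose r hr using hmin
  refine ⟨Finset.univ.filter fun a => ∃ b, p ≤ ∑ i ∈ Finset.Icc a b, D i, r, fun a ha => ?_,
    fun a b hab => ⟨?_, (hr a ⟨b, hab⟩).2 b hab⟩⟩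
  · exact (hr a (Finset.mem_filter.1 ha).2).1
  · exact Finset.mem_filter.2 ⟨Finset.mem_univ a, b, hab⟩

/-- With m ≥ √n/ε samples from 𝒟 on [n], with probability at least 1 − n^{−99}
every interval of mass at least 100·ε·ln n/√n contains a sampled element. -/
theorem sketch_interval_coverage
    (n : ℕ) (hn : 2 ≤ n) (ε : ℝ) (hε0 : 0 < ε) (hε1 : ε ≤ 1)
    (hcond : 100 * ε * Real.log n ≤ Real.sqrt n)
    (D : Fin n → ℝ) (hD0 : ∀ i, 0 ≤ D i) (hD1 : ∑ i, D i = 1)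
    (m : ℕ) (hm : Real.sqrt n / ε ≤ (m : ℝ)) :
    1 - ((n : ℝ) ^ 99)⁻¹ ≤
      ∑ X : Fin m → Fin n,
        (if ∀ a b : Fin n, a ≤ b →
            (100 * ε * Real.log n / Real.sqrt n ≤ ∑ i ∈ Finset.Icc a b, D i) →
            ∃ j, X j ∈ Finset.Icc a b
         then ∏ i, D (X i) else 0) := by
  obtain ⟨A, r, hA, hr⟩ :=
    exists_shortest_heavy_interval n D (100 * ε * Real.log n / Real.sqrt n)
  have hn0 : (0 : ℝ) < n := by positivity
  have hbound : A.card * (1 - 100 * ε * Real.log n / Real.sqrt n) ^ m ≤ ((n : ℝ) ^ 99)⁻¹ := by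
    have hcard : (A.card : ℝ) ≤ n := by exact_mod_cast card_finset_fin_le A
    calc A.card * (1 - 100 * ε * Real.log n / Real.sqrt n) ^ m
        ≤ A.card * ((n : ℝ) ^ 100)⁻¹ := mul_le_mul_of_nonneg_left
          (one_sub_pow_le_inv_pow n hn ε hε0 hcond m hm) (by positivity)
      _ ≤ n * ((n : ℝ) ^ 100)⁻¹ := mul_le_mul_of_nonneg_right hcard (by positivity)
      _ = ((n : ℝ) ^ 99)⁻¹ := by
          rw [pow_succ (n : ℝ) 99, mul_inv_rev, mul_inv_cancel_left₀ hn0.ne']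
  refine (sub_le_sub_left hbound 1).trans <|
    (one_sub_card_mul_le_prob_hit D hD0 hD1 m A (fun a => Finset.Icc a (r a)) _ hA).trans <|
    Finset.sum_le_sum fun X _ => ?_
  have hX : 0 ≤ ∏ i, D (X i) := Finset.prod_nonneg fun i _ => hD0 _
  split_ifs with hhit hcover hcover
  · exact le_rfl
  · refine absurd (fun a b _ hab => ?_) hcover
    obtain ⟨ha, hle⟩ := hr a b hab
    obtain ⟨j, hj⟩ := hhit a ha
    exact ⟨j, Finset.Icc_subset_Icc_right hle hj⟩
  · exact hX
  · exact le_rfl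
end

section
/- Let n, t, m be positive integers with t ≤ n and m·t ≤ n/10. Let y⁽¹⁾, …, y⁽ᵐ⁾ be independent samples from the uniform distribution on {y ∈ {0,1}ⁿ : ‖y‖₁ = n − t}. Then with probability at least 1 − m·10^{−t}, the set {y⁽¹⁾, …, y⁽ᵐ⁾} is shattered by the class of monotone conjunctions, i.e., for every sequence of bits b⁽¹⁾, …, b⁽ᵐ⁾ ∈ {0,1} there exists a set E ⊆ [n] such that the function f(x) = ⋀_{i∈E} x_i satisfies f(y⁽ᵏ⁾) = b⁽ᵏ⁾ for all k ∈ [m]. -/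
open scoped Classical

/-- If `10 * u ≤ n`, then a uniform `t`-subset of an `n`-set lies in a fixed `u`-subset with
probability at most `10⁻ᵗ`. -/
lemma ten_pow_mul_choose_le {u n : ℕ} (h : 10 * u ≤ n) (t : ℕ) :
    10 ^ t * u.choose t ≤ n.choose t := by
  have key : 10 ^ t * u.descFactorial t ≤ n.descFactorial t := by
    induction t with
    | zero => simp
    | succ k ih =>
      rw [Nat.descFactorial_succ, Nat.descFactorial_succ]
      calc 10 ^ (k + 1) * ((u - k) * u.descFactorial k)
          = (10 * (u - k)) * (10 ^ k * u.descFactorial k) := by ring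
        _ ≤ (n - k) * n.descFactorial k := Nat.mul_le_mul (by omega) ih
  rw [Nat.descFactorial_eq_factorial_mul_choose, Nat.descFactorial_eq_factorial_mul_choose] at key
  refine Nat.le_of_mul_le_mul_left ?_ t.factorial_pos
  linarith

lemma card_filter_true_eq_sub_iff {n t : ℕ} (htn : t ≤ n) (y : Fin n → Bool) :
    (Finset.univ.filter fun i => y i = true).card = n - t ↔
      (Finset.univ.filter fun i => y i = false).card = t := by
  have h := Finset.card_filter_add_card_filter_not (s := (Finset.univ : Finset (Fin n)))
    (fun i => y i = true)
  simp only [Bool.not_eq_true, Finset.card_univ, Fintype.card_fin] at h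
  omega

lemma card_filter_slice_zeros_subset {n t : ℕ} (htn : t ≤ n) (U : Finset (Fin n)) :
    (Finset.univ.filter fun y : Fin n → Bool =>
      (Finset.univ.filter fun i => y i = true).card = n - t ∧ ∀ i, y i = false → i ∈ U).card
      = U.card.choose t := by
  rw [← Finset.card_powersetCard]
  refine Finset.card_nbij' (fun y => Finset.univ.filter fun i => y i = false)
    (fun s i => decide (i ∉ s)) ?_ ?_ ?_ ?_
  · intro y hy
    simp only [card_filter_true_eq_sub_iff htn, Finset.coe_filter, Finset.mem_univ, true_and,
      Set.mem_ofPred_eq] at hy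
    simp only [Finset.mem_coe, Finset.mem_powersetCard]
    exact ⟨fun i hi => hy.2 i (by simpa using hi), hy.1⟩
  · intro s hs
    simp only [Finset.mem_coe, Finset.mem_powersetCard] at hs
    simp only [card_filter_true_eq_sub_iff htn, Finset.coe_filter, Finset.mem_univ, true_and,
      Set.mem_ofPred_eq]
    simpa using ⟨hs.2, fun i hi => hs.1 hi⟩
  · intro y _
    funext i
    simp
  · intro s _
    ext i
    simp

/-- The uniform probability mass function on the slice of points with `n - t` ones. -/
noncomputable def sliceMass (n t : ℕ) (y : Fin n → Bool) : ℝ :=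
  if (Finset.univ.filter fun i => y i = true).card = n - t then ((n.choose t : ℝ))⁻¹ else 0

lemma sliceMass_nonneg (n t : ℕ) (y : Fin n → Bool) : 0 ≤ sliceMass n t y := by
  unfold sliceMass; positivity

lemma sum_sliceMass_zeros_subset {n t : ℕ} (htn : t ≤ n) (U : Finset (Fin n)) :
    ∑ y : Fin n → Bool, (if ∀ i, y i = false → i ∈ U then sliceMass n t y else 0)
      = (U.card.choose t : ℝ) * (n.choose t : ℝ)⁻¹ := by
  rw [← card_filter_slice_zeros_subset htn U, ← nsmul_eq_mul, ← Finset.sum_const,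
    Finset.sum_filter]
  refine Finset.sum_congr rfl fun y _ => ?_
  unfold sliceMass
  split_ifs <;> simp_all

lemma choose_cast_ne_zero {n t : ℕ} (htn : t ≤ n) : (n.choose t : ℝ) ≠ 0 := by
  exact_mod_cast (Nat.choose_pos htn).ne'

lemma sum_sliceMass {n t : ℕ} (htn : t ≤ n) : ∑ y, sliceMass n t y = 1 := by
  have h := sum_sliceMass_zeros_subset htn Finset.univ
  simpa [choose_cast_ne_zero htn] using h

lemma sum_sliceMass_zeros_subset_le {n t : ℕ} (htn : t ≤ n) {U : Finset (Fin n)}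
    (hU : 10 * U.card ≤ n) :
    ∑ y : Fin n → Bool, (if ∀ i, y i = false → i ∈ U then sliceMass n t y else 0)
      ≤ (1 / 10) ^ t := by
  have h : (10 : ℝ) ^ t * U.card.choose t ≤ n.choose t := by
    exact_mod_cast ten_pow_mul_choose_le hU t
  have hpos : (0 : ℝ) < n.choose t := by exact_mod_cast Nat.choose_pos htn
  rw [sum_sliceMass_zeros_subset htn, ← div_eq_mul_inv, one_div, inv_pow, ← one_div,
    div_le_div_iff₀ hpos (by positivity)]
  linarith

lemma sum_prod_sliceMass {n t m : ℕ} (htn : t ≤ n) :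
    ∑ Y : Fin m → Fin n → Bool, ∏ k, sliceMass n t (Y k) = 1 := by
  rw [← Fintype.prod_sum fun (_ : Fin m) y => sliceMass n t y]
  simp [sum_sliceMass htn]

/-- The `k`-th point has no private zero: each of its zeros is a zero of another point. -/
def ZerosCovered {n m : ℕ} (Y : Fin m → Fin n → Bool) (k : Fin m) : Prop :=
  ∀ i, Y k i = false → ∃ j, j ≠ k ∧ Y j i = false

lemma shattered_of_forall_not_zerosCovered {n m : ℕ} {Y : Fin m → Fin n → Bool}
    (h : ∀ k, ¬ ZerosCovered Y k) (b : Fin m → Bool) :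
    ∃ E : Finset (Fin n), ∀ k : Fin m, ((∀ i ∈ E, Y k i = true) ↔ b k = true) := by
  simp only [ZerosCovered, not_forall, not_exists, not_and, Bool.not_eq_false, exists_prop] at h
  choose e he hpriv using h
  refine ⟨(Finset.univ.filter fun k => b k = false).image e, fun k => ?_⟩
  simp only [Finset.mem_image, Finset.mem_filter, Finset.mem_univ, true_and,
    forall_exists_index, and_imp, forall_apply_eq_imp_iff₂]
  constructor
  · intro H
    by_contra hb
    have := H k (by simpa using hb)
    simp [he k] at this
  · intro hb j hj
    exact hpriv j k (by rintro rfl; simp [hb] at hj)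

lemma sum_prod_sliceMass_zerosCovered_le {n t m : ℕ} (htn : t ≤ n) (hmt : 10 * (m * t) ≤ n)
    (k : Fin m) :
    ∑ Y : Fin m → Fin n → Bool,
      (if ZerosCovered Y k then ∏ j, sliceMass n t (Y j) else 0) ≤ (1 / 10) ^ t := by
  obtain _ | m := m
  · exact k.elim0
  rw [← (Fin.insertNthEquiv (fun _ => Fin n → Bool) k).sum_comp, Fintype.sum_prod_type_right]
  calc _ ≤ ∑ R : Fin m → Fin n → Bool, (∏ j, sliceMass n t (R j)) * (1 / 10) ^ t := ?_
    _ = (1 / 10) ^ t := by rw [← Finset.sum_mul, sum_prod_sliceMass htn, one_mul]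
  refine Finset.sum_le_sum fun R _ => ?_
  set U : Finset (Fin n) :=
    Finset.univ.biUnion fun j => Finset.univ.filter fun i => R j i = false with hUdef
  have hcov (y : Fin n → Bool) :
      ZerosCovered (Fin.insertNthEquiv (fun _ => Fin n → Bool) k (y, R)) k ↔
        ∀ i, y i = false → i ∈ U := by
    simp [ZerosCovered, hUdef, Fin.exists_iff_succAbove k]
  have hsum : ∑ y : Fin n → Bool,
      (if ZerosCovered (Fin.insertNthEquiv (fun _ => Fin n → Bool) k (y, R)) k then
        ∏ j, sliceMass n t (Fin.insertNthEquiv (fun _ => Fin n → Bool) k (y, R) j) else 0) =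
      (∏ j, sliceMass n t (R j)) *
        ∑ y : Fin n → Bool, (if ∀ i, y i = false → i ∈ U then sliceMass n t y else 0) := by
    rw [Finset.mul_sum]
    refine Finset.sum_congr rfl fun y _ => ?_
    simp only [hcov, Fin.prod_univ_succAbove _ k, mul_ite, mul_zero]
    simp [mul_comm]
  rw [hsum]
  by_cases hR : ∏ j, sliceMass n t (R j) = 0
  · simp [hR]
  refine mul_le_mul_of_nonneg_left (sum_sliceMass_zeros_subset_le htn ?_)
    (Finset.prod_nonneg fun j _ => sliceMass_nonneg n t (R j))
  have hcard : U.card ≤ m * t := by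
    refine (Finset.card_biUnion_le_card_mul _ _ t fun j _ => ?_).trans (by simp)
    have hj := Finset.prod_ne_zero_iff.mp hR j (Finset.mem_univ j)
    refine ((card_filter_true_eq_sub_iff htn (R j)).mp ?_).le
    by_contra hne
    exact hj (if_neg hne)
  nlinarith

/-- Lemma 8.4 (generalized): m independent uniform samples from the slice
{y ∈ {0,1}ⁿ : ‖y‖₁ = n − t}, with m·t ≤ n/10, are shattered by monotone
conjunctions with probability at least 1 − m·10^{−t}. -/
theorem random_shattering
    (n t m : ℕ) (hn : 0 < n) (ht : 0 < t) (hm : 0 < m)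
    (htn : t ≤ n) (hmt : (m : ℝ) * (t : ℝ) ≤ (n : ℝ) / 10) :
    1 - (m : ℝ) * (1 / 10) ^ t ≤
      ∑ Y : Fin m → Fin n → Bool,
        (if ∀ b : Fin m → Bool, ∃ E : Finset (Fin n),
            ∀ k : Fin m, ((∀ i ∈ E, Y k i = true) ↔ b k = true)
         then ∏ k, (if (Finset.univ.filter fun i => Y k i = true).card = n - t
                    then ((n.choose t : ℝ))⁻¹ else 0)
         else 0) := by
  have hmt' : 10 * (m * t) ≤ n := by
    have : (10 : ℝ) * (m * t) ≤ n := by linarith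
    exact_mod_cast this
  change _ ≤ ∑ Y : Fin m → Fin n → Bool,
    (if ∀ b : Fin m → Bool, ∃ E : Finset (Fin n),
        ∀ k : Fin m, ((∀ i ∈ E, Y k i = true) ↔ b k = true)
      then ∏ k, sliceMass n t (Y k) else 0)
  have hbad : ∑ Y : Fin m → Fin n → Bool, ∑ k,
      (if ZerosCovered Y k then ∏ j, sliceMass n t (Y j) else 0) ≤ m * (1 / 10) ^ t := by
    rw [Finset.sum_comm]
    refine (Finset.sum_le_sum fun k _ =>
      sum_prod_sliceMass_zerosCovered_le htn hmt' k).trans (by simp)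
  rw [sub_le_iff_le_add]
  refine (sum_prod_sliceMass (m := m) htn).ge.trans (le_trans ?_ (add_le_add le_rfl hbad))
  rw [← Finset.sum_add_distrib]
  refine Finset.sum_le_sum fun Y _ => ?_
  have hprod : 0 ≤ ∏ j, sliceMass n t (Y j) :=
    Finset.prod_nonneg fun j _ => sliceMass_nonneg n t (Y j)
  have hterm (k : Fin m) :
      0 ≤ if ZerosCovered Y k then ∏ j, sliceMass n t (Y j) else 0 := by
    split_ifs <;> simp [hprod]
  by_cases h : ∀ k, ¬ ZerosCovered Y k
  · rw [if_pos (shattered_of_forall_not_zerosCovered h)]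
    exact le_add_of_nonneg_right (Finset.sum_nonneg fun k _ => hterm k)
  · push Not at h
    obtain ⟨k, hk⟩ := h
    have hle := Finset.single_le_sum (fun k _ => hterm k) (Finset.mem_univ k)
    rw [if_pos hk] at hle
    refine hle.trans (le_add_of_nonneg_left ?_)
    split_ifs <;> simp [hprod]
end
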